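/- arXiv:1810.12811 — 3 statements merged into one kernel-verified Lean document; each statement's English description precedes it below -/
import Mathlib

section
/- Let h have reduced Witt index n ≥ 2, anisotropic defect d₀ and singular defect d (so N = 2n + d₀ + d); h may be degenerate. Then for every integer k with 1 ≤ k ≤ n, the Grassmann image G_k(h) equals all of ⋀^k V; in particular dim G_k(h) = binom(N, k). -/
noncomputable section

namespace PolarGrass

open Module

variable (F : Type*) [Field F] (V : Type*) [AddCommGroup V] [Module F V]

/-- A subspace `W` is totally singular for the pairing `B` if `B` vanishes identically on it. -/
def TotSingB (B : V → V → F) (W : Submodule F V) : Prop :=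
  ∀ x ∈ W, ∀ y ∈ W, B x y = 0

/-- A subspace `W` is totally singular for the quadratic form `q` if `q` vanishes on it. -/
def TotSingQ (q : QuadraticForm F V) (W : Submodule F V) : Prop :=
  ∀ x ∈ W, q x = 0

/-- The polarization of a quadratic form, as a bare pairing. -/
def polarF (q : QuadraticForm F V) : V → V → F :=
  fun x y => QuadraticMap.polar (⇑q) x y

/-- The subspace of the `k`-th exterior power of `V` spanned by the pure wedges
`v₁ ∧ ⋯ ∧ v_k` where `v₁, …, v_k` is a basis of a `k`-dimensional subspace satisfying `P`,
all of whose vectors lie in `U`. -/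
def grassmannIn (P : Submodule F V → Prop) (U : Submodule F V) (k : ℕ) :
    Submodule F (ExteriorAlgebra F V) :=
  Submodule.span F {x | ∃ v : Fin k → V, (∀ t, v t ∈ U) ∧ LinearIndependent F v ∧
    P (Submodule.span F (Set.range v)) ∧ x = ExteriorAlgebra.ιMulti F k v}

/-- The Grassmann image: the subspace of the `k`-th exterior power of `V` spanned by the
pure wedges of bases of `k`-dimensional subspaces of `V` satisfying `P`. -/
def grassmann (P : Submodule F V → Prop) (k : ℕ) : Submodule F (ExteriorAlgebra F V) :=
  grassmannIn F V P ⊤ k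

/-- `B` is a `σ`-Hermitian form. -/
def IsHermitianForm (σ : F ≃+* F) (B : V → V → F) : Prop :=
  (∀ x y z : V, B (x + y) z = B x z + B y z) ∧
  (∀ x y z : V, B x (y + z) = B x y + B x z) ∧
  (∀ (a b : F) (x y : V), B (a • x) (b • y) = σ a * b * B x y) ∧
  (∀ x y : V, B y x = σ (B x y))

/-- `B` is an alternating bilinear form. -/
def IsAlternatingForm (B : V → V → F) : Prop :=
  (∀ x y z : V, B (x + y) z = B x z + B y z) ∧
  (∀ x y z : V, B x (y + z) = B x y + B x z) ∧
  (∀ (a : F) (x y : V), B (a • x) y = a * B x y) ∧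
  (∀ (a : F) (x y : V), B x (a • y) = a * B x y) ∧
  (∀ x : V, B x x = 0)

/-- `V` is the orthogonal (w.r.t. the pairing `B`) direct sum of the subspaces
`W 0, …, W (n-1), W₀, R`, where each `W i` is a hyperbolic plane (spanned by two singular
vectors pairing to `1`, singularity being measured by `sv`), `W₀` is anisotropic of
dimension `d₀` (it contains no nonzero singular vector) and `R` is the radical
(given as the set `RadSet`) and has dimension `d`. -/
def IsWittDecomp (B : V → V → F) (sv : V → Prop) (RadSet : Set V) (n d₀ d : ℕ)
    (W : Fin n → Submodule F V) (W₀ R : Submodule F V) : Prop :=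
  DirectSum.IsInternal (Sum.elim W ![W₀, R]) ∧
  (∀ j j' : Fin n ⊕ Fin 2, j ≠ j' →
    ∀ x ∈ Sum.elim W ![W₀, R] j, ∀ y ∈ Sum.elim W ![W₀, R] j', B x y = 0) ∧
  (∀ i : Fin n, ∃ e f : V, W i = Submodule.span F {e, f} ∧ sv e ∧ sv f ∧ B e f = 1) ∧
  (∀ v ∈ W₀, v ≠ 0 → ¬ sv v) ∧
  Module.finrank F W₀ = d₀ ∧
  (R : Set V) = RadSet ∧
  Module.finrank F R = d

/-- There is a Witt decomposition of `V` as above: `B` has reduced Witt index `n`,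
anisotropic defect `d₀` and singular defect `d`. -/
def HasWittDecomp (B : V → V → F) (sv : V → Prop) (RadSet : Set V) (n d₀ d : ℕ) : Prop :=
  ∃ (W : Fin n → Submodule F V) (W₀ R : Submodule F V),
    IsWittDecomp F V B sv RadSet n d₀ d W W₀ R

/-- The radical (as a set) of a sesquilinear/bilinear pairing. -/
def radSetB (B : V → V → F) : Set V := {v | ∀ w, B v w = 0}

/-- The radical (as a set) of a quadratic form. -/
def radSetQ (q : QuadraticForm F V) : Set V :=
  {v | q v = 0 ∧ ∀ w, polarF F V q v w = 0}

/-- The image of `⋀^i U` inside the exterior algebra of `V`: the span of the pure wedges of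
`i`-tuples of vectors of `U`. -/
def extPowOf (U : Submodule F V) (i : ℕ) : Submodule F (ExteriorAlgebra F V) :=
  Submodule.span F {x | ∃ v : Fin i → V, (∀ t, v t ∈ U) ∧ x = ExteriorAlgebra.ιMulti F i v}

/-- `Ḡ_j`: for `j ≥ 1` the span of the pure wedges of bases of `j`-dimensional subspaces of
`U` satisfying `P`; for `j = 0` the scalars `F ⊆ ⋀^0 V`. -/
def gbar (P : Submodule F V → Prop) (U : Submodule F V) : ℕ → Submodule F (ExteriorAlgebra F V)
  | 0 => 1
  | (j + 1) => grassmannIn F V P U (j + 1)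

end PolarGrass

namespace PolarGrassAux

open Submodule

section

variable {F : Type*} [Field F] {V : Type*} [AddCommGroup V] [Module F V]
  {σ : F →+* F} (L : V →ₛₗ[σ] V →ₗ[F] F)

/-- The vectors orthogonal to `v`. -/
def perp (v : V) : Submodule F V := LinearMap.ker (L v)

lemma mem_perp {v w : V} : w ∈ perp L v ↔ L v w = 0 := LinearMap.mem_ker

/-- `U` contains `m` mutually orthogonal hyperbolic pairs. -/
def Hyp : ℕ → Submodule F V → Prop
  | 0, _ => True
  | m + 1, U => ∃ e ∈ U, ∃ f ∈ U, L e e = 0 ∧ L f f = 0 ∧ L e f = 1 ∧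
      Hyp m (U ⊓ perp L e ⊓ perp L f)

lemma Hyp.map {m : ℕ} : ∀ {U U' : Submodule F V} (g : V → V),
    (∀ u ∈ U, g u ∈ U') → (∀ u ∈ U, ∀ v ∈ U, L (g u) (g v) = L u v) →
    Hyp L m U → Hyp L m U' := by
  induction m with
  | zero => intros; trivial
  | succ m ih =>
    rintro U U' g h1 h2 ⟨e, he, f, hf, hee, hff, hef, hr⟩
    refine ⟨g e, h1 e he, g f, h1 f hf, by rw [h2 e he e he, hee], by rw [h2 f hf f hf, hff],
      by rw [h2 e he f hf, hef], ih g ?_ ?_ hr⟩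
    · rintro u ⟨⟨hu, hue⟩, huf⟩
      refine ⟨⟨h1 u hu, ?_⟩, ?_⟩
      · exact (mem_perp L).2 (by rw [h2 e he u hu]; exact (mem_perp L).1 hue)
      · exact (mem_perp L).2 (by rw [h2 f hf u hu]; exact (mem_perp L).1 huf)
    · rintro u ⟨⟨hu, -⟩, -⟩ v ⟨⟨hv, -⟩, -⟩
      exact h2 u hu v hv

lemma Hyp.mono {m : ℕ} {U U' : Submodule F V} (hU : U ≤ U') (h : Hyp L m U) : Hyp L m U' :=
  Hyp.map L id (fun _ hu => hU hu) (fun _ _ _ _ => rfl) h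

lemma hyp_of_family {m : ℕ} : ∀ {U : Submodule F V} (e f : Fin m → V),
    (∀ i, e i ∈ U) → (∀ i, f i ∈ U) → (∀ i, L (e i) (e i) = 0) → (∀ i, L (f i) (f i) = 0) →
    (∀ i, L (e i) (f i) = 1) →
    (∀ i j, i ≠ j → L (e i) (e j) = 0 ∧ L (e i) (f j) = 0 ∧ L (f i) (e j) = 0 ∧
      L (f i) (f j) = 0) → Hyp L m U := by
  induction m with
  | zero => intros; trivial
  | succ m ih =>
    intro U e f he hf hee hff hef ho
    refine ⟨e 0, he 0, f 0, hf 0, hee 0, hff 0, hef 0,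
      ih (fun i => e i.succ) (fun i => f i.succ) ?_ ?_ (fun i => hee _) (fun i => hff _)
        (fun i => hef _) (fun i j hij => ho _ _ (by simpa using hij))⟩
    · intro i
      have := ho 0 i.succ (Fin.succ_ne_zero i).symm
      exact ⟨⟨he _, (mem_perp L).2 this.1⟩, (mem_perp L).2 this.2.2.1⟩
    · intro i
      have := ho 0 i.succ (Fin.succ_ne_zero i).symm
      exact ⟨⟨hf _, (mem_perp L).2 this.2.1⟩, (mem_perp L).2 this.2.2.2⟩

/-- Totally singular tuples of `U` whose orthogonal space in `U` has `m` hyperbolic pairs. -/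
structure TT {k : ℕ} (m : ℕ) (U : Submodule F V) (x : Fin k → V) : Prop where
  mem : ∀ i, x i ∈ U
  sing : ∀ i j, L (x i) (x j) = 0
  hyp : Hyp L m (U ⊓ ⨅ i, perp L (x i))

lemma TT.cons (herm : ∀ x y, L y x = σ (L x y)) {k m : ℕ} {U U' : Submodule F V}
    {x : Fin k → V} {e : V} (he : e ∈ U) (hee : L e e = 0)
    (hU : U' ≤ U) (hx : ∀ i, x i ∈ U') (hs : ∀ i j, L (x i) (x j) = 0)
    (hex : ∀ i, L e (x i) = 0) (hyp : Hyp L m U')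
    (h1 : ∀ u ∈ U', L e u = 0 ) (hy : Hyp L m (U' ⊓ ⨅ i, perp L (x i))) :
    TT L m U (Matrix.vecCons e x) := by
  refine ⟨?_, ?_, ?_⟩
  · intro i
    refine Fin.cases ?_ (fun i => ?_) i
    · simpa using he
    · simpa using hU (hx i)
  · intro i j
    refine Fin.cases ?_ (fun i => ?_) i <;> refine Fin.cases ?_ (fun j => ?_) j
    · simpa using hee
    · simpa using hex j
    · simpa [herm e (x i)] using hex i
    · simpa using hs i j
  · refine Hyp.mono L ?_ hy
    rintro u ⟨hu, hu2⟩
    refine ⟨hU hu, ?_⟩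
    simp only [SetLike.mem_coe, Submodule.mem_iInf] at hu2 ⊢
    intro i
    refine Fin.cases ?_ (fun i => ?_) i
    · simpa using (mem_perp L).2 (h1 u hu)
    · simpa using hu2 i

variable {M : Type*} [AddCommGroup M] [Module F M]

lemma span_vanish {k : ℕ} : ∀ (S : Set V) (φ : V [⋀^Fin k]→ₗ[F] M),
    (∀ x : Fin k → V, (∀ i, x i ∈ S) → φ x = 0) →
    ∀ x : Fin k → V, (∀ i, x i ∈ span F S) → φ x = 0 := by
  induction k with
  | zero => intro S φ h x _; exact h x (fun i => i.elim0)
  | succ k ih =>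
    intro S φ h x hx
    have key : ∀ z ∈ span F S, φ.curryLeft z (Matrix.vecTail x) = 0 := by
      intro z hz
      induction hz using Submodule.span_induction with
      | mem z hz =>
        refine ih S _ (fun y hy => ?_) _ (fun i => hx _)
        rw [AlternatingMap.curryLeft_apply_apply]
        apply h
        intro i
        refine Fin.cases ?_ (fun i => ?_) i
        · simpa using hz
        · simpa using hy i
      | zero => simp only [map_zero, AlternatingMap.zero_apply]
      | add a b _ _ ha hb => rw [map_add, AlternatingMap.add_apply, ha, hb, add_zero]
      | smul c a _ ha => rw [map_smul, AlternatingMap.smul_apply, ha, smul_zero]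
    have := key (x 0) (hx 0)
    rw [AlternatingMap.curryLeft_apply_apply] at this
    rw [← this]
    congr 1
    exact (Matrix.cons_head_tail x).symm

/-- Case analysis on a tuple with entries `e`, `f` or in `H`. -/
lemma tuple_vanish {k : ℕ} (S H : Set V) (e f : V) (hS : ∀ x ∈ S, x = e ∨ x = f ∨ x ∈ H)
    (ψ : V [⋀^Fin k]→ₗ[F] M)
    (he : ∀ x : Fin k → V, (∃ i, x i = e) → ψ x = 0)
    (hf : ∀ x : Fin k → V, (∀ i, x i ∈ H ∨ x i = f) → (∃ i, x i = f ∧ ∀ j, j ≠ i → x j ∈ H) →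
      ψ x = 0)
    (hH : ∀ x : Fin k → V, (∀ i, x i ∈ H) → ψ x = 0) :
    ∀ x : Fin k → V, (∀ i, x i ∈ S) → ψ x = 0 := by
  intro x hx
  by_cases h1 : ∃ i, x i = e
  · exact he x h1
  push Not at h1
  have h2 : ∀ i, x i ∈ H ∨ x i = f := fun i => by
    rcases hS _ (hx i) with h | h | h
    · exact absurd h (h1 i)
    · exact Or.inr h
    · exact Or.inl h
  by_cases h3 : ∀ i, x i ∈ H
  · exact hH x h3
  push Not at h3
  obtain ⟨i, hi⟩ := h3
  have hif : x i = f := (h2 i).resolve_left hi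
  by_cases h4 : ∃ j, j ≠ i ∧ x j = f
  · obtain ⟨j, hj, hjf⟩ := h4
    exact ψ.map_eq_zero_of_eq x (hjf.trans hif.symm) hj
  push Not at h4
  exact hf x h2 ⟨i, hif, fun j hj => (h2 j).resolve_right (h4 j hj)⟩

/-- The main induction statement. -/
def Claim (M : Type*) [AddCommGroup M] [Module F M] (k : ℕ) : Prop :=
  ∀ (m : ℕ) (U : Submodule F V) (φ : V [⋀^Fin k]→ₗ[F] M), Hyp L (k + m) U →
    (∀ x : Fin k → V, TT L m U x → φ x = 0) → ∀ x : Fin k → V, (∀ i, x i ∈ U) → φ x = 0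

lemma claim_zero : Claim L M 0 := by
  intro m U φ hU hφ x _
  refine hφ x ⟨fun i => i.elim0, fun i => i.elim0, ?_⟩
  refine Hyp.mono L ?_ (by simpa using hU)
  simp

/-- Vanishing when the first two entries are a hyperbolic pair, the others orthogonal to them. -/
lemma vanish_ef (herm : ∀ x y, L y x = σ (L x y)) (b : F) (hb : σ b ≠ b) {k : ℕ}
    (hk : Claim L M k) {m : ℕ} {U : Submodule F V}
    (φ : V [⋀^Fin (k + 2)]→ₗ[F] M) (hφ : ∀ x, TT L m U x → φ x = 0) {e f : V} (he : e ∈ U)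
    (hf : f ∈ U) (hee : L e e = 0) (hff : L f f = 0) (hef : L e f = 1)
    (hH : Hyp L (k + 1 + m) (U ⊓ perp L e ⊓ perp L f)) (x : Fin k → V)
    (hx : ∀ i, x i ∈ U ⊓ perp L e ⊓ perp L f) :
    φ (Matrix.vecCons e (Matrix.vecCons f x)) = 0 := by
  refine hk (m + 1) _ ((φ.curryLeft e).curryLeft f) (by
    rwa [show k + (m + 1) = k + 1 + m by ring]) ?_ x hx
  clear hx x
  rintro x ⟨hxm, hxs, e2, ⟨⟨⟨he2U, he2e⟩, he2f⟩, he2x⟩, f2, ⟨⟨⟨hf2U, hf2e⟩, hf2f⟩, hf2x⟩,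
    he2e2, hf2f2, he2f2, hyp⟩
  simp only [SetLike.mem_coe, Submodule.mem_iInf, mem_perp] at he2e he2f he2x hf2e hf2f hf2x
  have hfe : L f e = 1 := by rw [herm e f, hef, map_one]
  have hf2e2 : L f2 e2 = 1 := by rw [herm e2 f2, he2f2, map_one]
  have hee2 : L e2 e = 0 := by rw [herm e e2, he2e, map_zero]
  have hfe2 : L e2 f = 0 := by rw [herm f e2, he2f, map_zero]
  have hef2 : L f2 e = 0 := by rw [herm e f2, hf2e, map_zero]
  have hff2 : L f2 f = 0 := by rw [herm f f2, hf2f, map_zero]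
  have hxe : ∀ i, L e (x i) = 0 := fun i => (mem_perp L).1 (hxm i).1.2
  have hxf : ∀ i, L f (x i) = 0 := fun i => (mem_perp L).1 (hxm i).2
  have hxe2 : ∀ i, L e2 (x i) = 0 := fun i => by rw [herm (x i) e2, he2x i, map_zero]
  have hxf2 : ∀ i, L f2 (x i) = 0 := fun i => by rw [herm (x i) f2, hf2x i, map_zero]
  -- the combined vectors
  have T : ∀ p q : V, (∃ a c : F, p = a • e + c • e2) → (∃ a c : F, q = a • f + c • f2) →
      L p q = 0 → φ (Matrix.vecCons p (Matrix.vecCons q x)) = 0 := by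
    rintro p q ⟨a, c, rfl⟩ ⟨a', c', rfl⟩ hpq
    have hqp := herm (a • e + c • e2) (a' • f + c' • f2)
    rw [hpq, map_zero] at hqp
    apply hφ
    refine ⟨?_, ?_, ?_⟩
    · intro i
      refine Fin.cases ?_ (fun i => Fin.cases ?_ (fun i => ?_) i) i
      · simpa using U.add_mem (U.smul_mem _ he) (U.smul_mem _ he2U)
      · simpa using U.add_mem (U.smul_mem _ hf) (U.smul_mem _ hf2U)
      · simpa using (hxm i).1.1
    · have hxe' : ∀ i, L (x i) e = 0 := fun i => by rw [herm e (x i), hxe i, map_zero]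
      have hxf' : ∀ i, L (x i) f = 0 := fun i => by rw [herm f (x i), hxf i, map_zero]
      intro i j
      refine Fin.cases ?_ (fun i => Fin.cases ?_ (fun i => ?_) i) i <;>
      refine Fin.cases ?_ (fun j => Fin.cases ?_ (fun j => ?_) j) j <;>
      simp only [Matrix.cons_val_zero, Matrix.cons_val_succ, hpq, hqp, hxs] <;>
      simp [hee, hff, he2e2, hf2f2, he2e, hee2, hf2f, hff2, hxe, hxf, hxe2, hxf2, hxe', hxf',
        he2x, hf2x]
    · refine Hyp.mono L ?_ hyp
      rintro u ⟨⟨⟨⟨⟨hu, hue⟩, huf⟩, hux⟩, hue2⟩, huf2⟩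
      simp only [SetLike.mem_coe, Submodule.mem_iInf, mem_perp] at hue huf hux hue2 huf2
      refine ⟨hu, ?_⟩
      simp only [SetLike.mem_coe, Submodule.mem_iInf, mem_perp]
      intro i
      refine Fin.cases ?_ (fun i => Fin.cases ?_ (fun i => ?_) i) i
      · simp [hue, hue2]
      · simp [huf, huf2]
      · simpa using hux i
  have Tz : ∀ p q : V, (∃ a c : F, p = a • e + c • e2) → (∃ a c : F, q = a • f + c • f2) →
      L p q = 0 → (φ.curryLeft p).curryLeft q x = 0 := fun p q h1 h2 h3 => T p q h1 h2 h3
  have z1 := Tz e f2 ⟨1, 0, by simp⟩ ⟨0, 1, by simp⟩ hf2e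
  have z2 := Tz e2 f ⟨0, 1, by simp⟩ ⟨1, 0, by simp⟩ hfe2
  have z3 : ∀ a c : F, 1 + σ a * c = 0 →
      (φ.curryLeft e).curryLeft f x + (a * c) • (φ.curryLeft e2).curryLeft f2 x = 0 := by
    intro a c hac
    have := Tz (e + a • e2) (f + c • f2) ⟨1, a, by simp⟩ ⟨1, c, by simp⟩
      (by simp [hef, hf2e, hfe2, he2f2]; linear_combination hac)
    simp only [map_add, map_smul, AlternatingMap.curryLeft_add, AlternatingMap.curryLeft_smul,
      LinearMap.add_apply, LinearMap.smul_apply, AlternatingMap.add_apply,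
      AlternatingMap.smul_apply, z1, z2, smul_zero, add_zero, zero_add, smul_smul] at this
    rw [← this, mul_comm a c]
  have hb0 : b ≠ 0 := by rintro rfl; exact hb (map_zero σ)
  have hsb0 : σ b ≠ 0 := by simpa using hb0
  have y1 := z3 1 (-1) (by simp)
  have y2 := z3 b (-(σ b)⁻¹) (by field_simp; ring)
  have y3 : (b * (-(σ b)⁻¹) + 1) • (φ.curryLeft e2).curryLeft f2 x = 0 := by
    have := congrArg₂ (· - ·) y2 y1
    simp only [add_sub_add_left_eq_sub, ← sub_smul, sub_zero] at this
    rw [← this]; congr 1; ring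
  have y4 : (φ.curryLeft e2).curryLeft f2 x = 0 := by
    refine (smul_eq_zero.1 y3).resolve_left fun h0 => hb ?_
    field_simp at h0
    linear_combination h0
  rw [y4, smul_zero, add_zero] at y1
  exact y1

/-- Vanishing when the first entry is a good singular vector. -/
lemma vanish_e (herm : ∀ x y, L y x = σ (L x y)) (b : F) (hb : σ b ≠ b) {k : ℕ}
    (ih : ∀ j ≤ k, Claim L M j) {m : ℕ} {U : Submodule F V}
    (φ : V [⋀^Fin (k + 1)]→ₗ[F] M) (hφ : ∀ x, TT L m U x → φ x = 0) {e f : V} (he : e ∈ U)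
    (hf : f ∈ U) (hee : L e e = 0) (hff : L f f = 0) (hef : L e f = 1)
    (hH : Hyp L (k + m) (U ⊓ perp L e ⊓ perp L f)) (x : Fin k → V)
    (hx : ∀ i, x i ∈ U) : φ (Matrix.vecCons e x) = 0 := by
  have hfe : L f e = 1 := by rw [herm e f, hef, map_one]
  -- vanishing on the orthogonal of `e`
  have A : ∀ x : Fin k → V, (∀ i, x i ∈ U ⊓ perp L e) → φ.curryLeft e x = 0 := by
    refine ih k le_rfl m _ _ (Hyp.mono L inf_le_left hH) ?_
    rintro x ⟨hm, hs, hy⟩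
    refine hφ _ (TT.cons L herm he hee (U' := U ⊓ perp L e) inf_le_left hm hs
      (fun i => (mem_perp L).1 (hm i).2) ?_ (fun u hu => (mem_perp L).1 hu.2) hy)
    exact Hyp.mono L inf_le_left hy
  have B : ∀ x : Fin k → V, (∀ i, x i ∈ ({e, f} ∪ (U ⊓ perp L e ⊓ perp L f : Submodule F V) : Set V)) →
      φ.curryLeft e x = 0 := by
    refine tuple_vanish _ (U ⊓ perp L e ⊓ perp L f : Submodule F V) e f ?_ _ ?_ ?_ ?_
    · rintro z ((h | h) | h)
      · exact Or.inl h
      · exact Or.inr (Or.inl h)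
      · exact Or.inr (Or.inr h)
    · rintro x ⟨i, hi⟩
      rw [AlternatingMap.curryLeft_apply_apply]
      exact φ.map_eq_zero_of_eq _ (i := 0) (j := i.succ) (by simp [hi])
        (Fin.succ_ne_zero i).symm
    · rintro x - ⟨i, hi, hj⟩
      cases k with
      | zero => exact i.elim0
      | succ k =>
        have key : ∀ y : Fin (k + 1) → V, y 0 = f →
            (∀ j, j ≠ 0 → y j ∈ (U ⊓ perp L e ⊓ perp L f : Submodule F V)) →
            φ.curryLeft e y = 0 := by
          intro y h0 hy
          have := vanish_ef L herm b hb (ih k (Nat.le_succ k)) φ hφ he hf hee hff hef hH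
            (Matrix.vecTail y) (fun i => hy _ (Fin.succ_ne_zero i))
          rw [← h0] at this
          rw [AlternatingMap.curryLeft_apply_apply, ← this]
          congr 2
          exact (Matrix.cons_head_tail y).symm
        by_cases hi0 : i = 0
        · subst hi0
          exact key x hi hj
        · have h1 := (φ.curryLeft e).map_swap x hi0
          rw [key (x ∘ Equiv.swap i 0) (by simp [hi]) ?_] at h1
          · exact neg_eq_zero.1 h1.symm
          · intro j hj0
            apply hj
            intro h
            apply hj0
            rw [Equiv.swap_apply_eq_iff] at h
            simpa using h
    · exact fun x hx => A x fun i => (hx i).1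
  refine span_vanish _ (φ.curryLeft e) B x fun i => ?_
  have hxi := hx i
  have dec : x i = (L f (x i)) • e + (L e (x i)) • f +
      (x i - (L f (x i)) • e - (L e (x i)) • f) := by abel
  rw [dec]
  refine add_mem (add_mem (smul_mem _ _ (subset_span (by simp)))
    (smul_mem _ _ (subset_span (by simp)))) (subset_span (Or.inr ?_))
  refine ⟨⟨?_, ?_⟩, ?_⟩
  · exact sub_mem (sub_mem hxi (smul_mem _ _ he)) (smul_mem _ _ hf)
  · exact (mem_perp L).2 (by simp [hee, hef])
  · exact (mem_perp L).2 (by simp [hff, hfe])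

lemma claim_succ (herm : ∀ x y, L y x = σ (L x y)) (hinv : ∀ a, σ (σ a) = a)
    (b : F) (hb : σ b ≠ b) {k : ℕ}
    (ih : ∀ j ≤ k, Claim L M j) : Claim L M (k + 1) := by
  intro m U φ hU hφ x hx
  rw [show k + 1 + m = (k + m) + 1 by ring] at hU
  obtain ⟨e, he, f, hf, hee, hff, hef, hH⟩ := hU
  have hfe : L f e = 1 := by rw [herm e f, hef, map_one]
  obtain ⟨a, ha⟩ : ∃ a : F, a + σ a ≠ 0 := by
    by_contra! hcon
    have h1 := hcon 1
    have h2 := hcon b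
    rw [map_one] at h1
    apply hb
    linear_combination h2 - b * h1
  have hxt : ∀ i, Matrix.vecTail x i ∈ U := fun i => hx _
  have Z1 : ∀ w ∈ U ⊓ perp L e ⊓ perp L f, ∃ c : F,
      φ.curryLeft (w + c • e + f) (Matrix.vecTail x) = 0 := by
    rintro w ⟨⟨hwU, hwe⟩, hwf⟩
    rw [SetLike.mem_coe, mem_perp] at hwe hwf
    have hwe' : L w e = 0 := by rw [herm e w, hwe, map_zero]
    have hwf' : L w f = 0 := by rw [herm f w, hwf, map_zero]
    have hww : σ (L w w) = L w w := (herm w w).symm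
    have hsa : σ (a + σ a) = a + σ a := by rw [map_add, hinv, add_comm]
    refine ⟨-(L w w) * a / (a + σ a), ?_⟩
    set c := -(L w w) * a / (a + σ a) with hc
    have hsc : c + σ c = - L w w := by
      rw [hc, map_div₀, hsa, map_mul, map_neg, hww]
      field_simp
      ring
    set y := w + c • e + f with hy
    have hyU : y ∈ U := add_mem (add_mem hwU (smul_mem _ _ he)) hf
    have hye : L y e = 1 := by simp [hy, hwe', hee, hfe]
    have hey : L e y = 1 := by simp [hy, hwe, hee, hef]
    have hyy : L y y = 0 := by
      simp [hy, hwe, hwe', hwf, hwf', hee, hff, hef, hfe]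
      linear_combination hsc
    refine vanish_e L herm b hb ih φ hφ hyU he hyy hee hye ?_ _ hxt
    refine Hyp.map L (fun v => v - L y v • e) ?_ ?_ hH
    · rintro u ⟨⟨hu, hue⟩, huf⟩
      rw [SetLike.mem_coe, mem_perp] at hue huf
      refine ⟨⟨sub_mem hu (smul_mem _ _ he), ?_⟩, ?_⟩
      · exact (mem_perp L).2 (by simp [hye])
      · exact (mem_perp L).2 (by simp [hue, hee])
    · rintro u ⟨⟨hu, hue⟩, huf⟩ v ⟨⟨hv, hve⟩, hvf⟩
      rw [SetLike.mem_coe, mem_perp] at hue huf hve hvf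
      have hue' : L u e = 0 := by rw [herm e u, hue, map_zero]
      simp [hue', hve, hee]
  have Ze : φ.curryLeft e (Matrix.vecTail x) = 0 :=
    vanish_e L herm b hb ih φ hφ he hf hee hff hef hH _ hxt
  have Zf : φ.curryLeft f (Matrix.vecTail x) = 0 := by
    refine vanish_e L herm b hb ih φ hφ hf he hff hee hfe (Hyp.mono L ?_ hH) _ hxt
    rw [inf_right_comm]
  have Zw : ∀ w ∈ U ⊓ perp L e ⊓ perp L f, φ.curryLeft w (Matrix.vecTail x) = 0 := by
    intro w hw
    obtain ⟨c, hc⟩ := Z1 w hw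
    simpa only [map_add, map_smul, AlternatingMap.add_apply, AlternatingMap.smul_apply, Ze, Zf,
      smul_zero, add_zero] using hc
  have fin : φ.curryLeft (x 0) (Matrix.vecTail x) = 0 := by
    have dec : x 0 = (L f (x 0)) • e + (L e (x 0)) • f +
      (x 0 - (L f (x 0)) • e - (L e (x 0)) • f) := by abel
    rw [dec, map_add, map_add, map_smul, map_smul, AlternatingMap.add_apply,
      AlternatingMap.add_apply, AlternatingMap.smul_apply, AlternatingMap.smul_apply, Ze, Zf,
      Zw, smul_zero, smul_zero, add_zero, add_zero]
    refine ⟨⟨?_, ?_⟩, ?_⟩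
    · exact sub_mem (sub_mem (hx 0) (smul_mem _ _ he)) (smul_mem _ _ hf)
    · exact (mem_perp L).2 (by simp [hee, hef])
    · exact (mem_perp L).2 (by simp [hff, hfe])
  rw [AlternatingMap.curryLeft_apply_apply] at fin
  rw [← fin]
  congr 1
  exact (Matrix.cons_head_tail x).symm

lemma claim_all (herm : ∀ x y, L y x = σ (L x y)) (hinv : ∀ a, σ (σ a) = a)
    (b : F) (hb : σ b ≠ b) (k : ℕ) : Claim L M k := by
  induction k using Nat.strong_induction_on with
  | _ k ih =>
    cases k with
    | zero => exact claim_zero L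
    | succ k => exact claim_succ L herm hinv b hb fun j hj => ih j (Nat.lt_succ_of_le hj)

end

end PolarGrassAux

open PolarGrass Module in
/-- a possibly degenerate σ-Hermitian form of reduced Witt index `n ≥ 2`,
anisotropic defect `d₀` and singular defect `d` (`N = 2n + d₀ + d`); for `1 ≤ k ≤ n` the
Grassmann image fills `⋀^k V`, of dimension `N.choose k`. -/
theorem stmt0 (F : Type*) [Field F] (V : Type*) [AddCommGroup V] [Module F V]
    [FiniteDimensional F V]
    (σ : F ≃+* F) (hσinv : ∀ a, σ (σ a) = a) (hσne : σ ≠ RingEquiv.refl F)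
    (h : V → V → F) (hherm : IsHermitianForm F V σ h)
    (n d₀ d N : ℕ) (hn : 2 ≤ n)
    (hdec : HasWittDecomp F V h (fun v => h v v = 0) (radSetB F V h) n d₀ d)
    (hNV : Module.finrank F V = N) (hN : N = 2 * n + d₀ + d) :
    ∀ k : ℕ, 1 ≤ k → k ≤ n →
      grassmann F V (TotSingB F V h) k = ⋀[F]^k V ∧
      Module.finrank F ↥(grassmann F V (TotSingB F V h) k) = N.choose k := by
  intro k _ hkn
  suffices hmain : grassmann F V (TotSingB F V h) k = ⋀[F]^k V by
    refine ⟨hmain, ?_⟩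
    rw [hmain, exteriorPower.finrank_eq, hNV]
  obtain ⟨hadd1, hadd2, hsmul, hsymm⟩ := hherm
  have hsmul1 : ∀ (a : F) (x y : V), h (a • x) y = σ a * h x y := fun a x y => by
    simpa using hsmul a 1 x y
  have hsmul2 : ∀ (a : F) (x y : V), h x (a • y) = a * h x y := fun a x y => by
    simpa using hsmul 1 a x y
  let L : V →ₛₗ[(σ : F →+* F)] V →ₗ[F] F :=
    LinearMap.mk₂'ₛₗ (σ : F →+* F) (RingHom.id F) h hadd1 hsmul1 hadd2 hsmul2
  have hL : ∀ x y, L x y = h x y := fun x y => rfl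
  obtain ⟨b, hb⟩ : ∃ b, σ b ≠ b := by
    by_contra! hcon
    exact hσne (RingEquiv.ext hcon)
  obtain ⟨W, W₀, R, -, horth, hpl, -⟩ := hdec
  choose e f hW he hf hef using hpl
  have heW : ∀ i, e i ∈ W i := fun i => by rw [hW i]; exact Submodule.subset_span (by simp)
  have hfW : ∀ i, f i ∈ W i := fun i => by rw [hW i]; exact Submodule.subset_span (by simp)
  have ho : ∀ i j, i ≠ j → ∀ x ∈ W i, ∀ y ∈ W j, h x y = 0 := fun i j hij x hx y hy =>
    horth (Sum.inl i) (Sum.inl j) (by simpa using hij) x hx y hy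
  have hyp : PolarGrassAux.Hyp L n ⊤ :=
    PolarGrassAux.hyp_of_family L e f (fun _ => trivial) (fun _ => trivial) he hf hef
      fun i j hij => ⟨ho i j hij _ (heW i) _ (heW j), ho i j hij _ (heW i) _ (hfW j),
        ho i j hij _ (hfW i) _ (heW j), ho i j hij _ (hfW i) _ (hfW j)⟩
  obtain ⟨m, rfl⟩ := Nat.exists_eq_add_of_le hkn
  rw [← exteriorPower.ιMulti_span_fixedDegree]
  apply le_antisymm
  · refine Submodule.span_mono ?_
    rintro _ ⟨v, -, -, -, rfl⟩
    exact ⟨v, rfl⟩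
  · rw [Submodule.span_le]
    rintro _ ⟨v, rfl⟩
    have := PolarGrassAux.claim_all (M := ExteriorAlgebra F V ⧸ grassmann F V (TotSingB F V h) k)
      L (fun x y => hsymm x y) hσinv b hb k m ⊤
      ((grassmann F V (TotSingB F V h) k).mkQ.compAlternatingMap (ExteriorAlgebra.ιMulti F k))
      hyp ?_ v (fun _ => trivial)
    · simpa using this
    · rintro x ⟨-, hs, -⟩
      simp only [LinearMap.compAlternatingMap_apply, Submodule.mkQ_apply,
        Submodule.Quotient.mk_eq_zero]
      by_cases hli : LinearIndependent F x
      · refine Submodule.subset_span ⟨x, fun _ => trivial, hli, ?_, rfl⟩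
        intro y hy z hz
        have h1 : ∀ i, ∀ z ∈ Submodule.span F (Set.range x), L (x i) z = 0 := by
          intro i z hz
          have : Submodule.span F (Set.range x) ≤ LinearMap.ker (L (x i)) := by
            rw [Submodule.span_le]
            rintro _ ⟨j, rfl⟩
            exact hs i j
          exact this hz
        have h2 : ∀ z ∈ Submodule.span F (Set.range x), ∀ i, h z (x i) = 0 := by
          intro z hz i
          rw [hsymm (x i) z, ← hL, h1 i z hz, map_zero]
        have : Submodule.span F (Set.range x) ≤ LinearMap.ker (L y) := by
          rw [Submodule.span_le]
          rintro _ ⟨j, rfl⟩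
          exact h2 y hy j
        exact this hz
      · rw [AlternatingMap.map_linearDependent _ x hli]
        exact zero_mem _
end
end

section
/- Let s have reduced Witt index n ≥ 2 and singular defect d (so N = 2n + d); s may be degenerate. Then for every integer k with 1 ≤ k ≤ n, dim G_k(s) = binom(N, k) − binom(N, k−2), with the convention binom(N, −1) := 0. -/
noncomputable section

namespace SympGrass

open Module

section Ops

variable {F : Type*} [Field F] {V : Type*} [AddCommGroup V] [Module F V]

/-- Contraction of the exterior algebra by a linear form. -/
def ct (δ : Dual F V) : ExteriorAlgebra F V →ₗ[F] ExteriorAlgebra F V :=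
  CliffordAlgebra.contractLeft (Q := (0 : QuadraticForm F V)) δ

/-- The embedding of `V` in its exterior algebra. -/
def io : V →ₗ[F] ExteriorAlgebra F V := ExteriorAlgebra.ι F

lemma ct_io_mul (δ : Dual F V) (v : V) (x : ExteriorAlgebra F V) :
    ct δ (io v * x) = δ v • x - io v * ct δ x :=
  CliffordAlgebra.contractLeft_ι_mul δ v x

lemma ct_ct (δ : Dual F V) (x : ExteriorAlgebra F V) : ct δ (ct δ x) = 0 :=
  CliffordAlgebra.contractLeft_contractLeft δ x

lemma ct_comm (δ δ' : Dual F V) (x : ExteriorAlgebra F V) :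
    ct δ (ct δ' x) = - ct δ' (ct δ x) :=
  CliffordAlgebra.contractLeft_comm δ δ' x

lemma ct_one (δ : Dual F V) : ct δ (1 : ExteriorAlgebra F V) = 0 :=
  CliffordAlgebra.contractLeft_one _ δ

lemma ct_algebraMap (δ : Dual F V) (a : F) :
    ct δ (algebraMap F (ExteriorAlgebra F V) a) = 0 :=
  CliffordAlgebra.contractLeft_algebraMap _ δ a

lemma ct_add (δ δ' : Dual F V) (x : ExteriorAlgebra F V) :
    ct (δ + δ') x = ct δ x + ct δ' x := by
  simp [ct]

lemma ct_sub (δ δ' : Dual F V) (x : ExteriorAlgebra F V) :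
    ct (δ - δ') x = ct δ x - ct δ' x := by
  simp [ct]

lemma ct_smul (a : F) (δ : Dual F V) (x : ExteriorAlgebra F V) :
    ct (a • δ) x = a • ct δ x := by
  simp [ct]

lemma ct_zero (x : ExteriorAlgebra F V) : ct (0 : Dual F V) x = 0 := by
  simp [ct]

lemma io_mul_self (v : V) (x : ExteriorAlgebra F V) : io (F := F) v * (io v * x) = 0 := by
  rw [← mul_assoc]
  have : io (F := F) v * io v = 0 := ExteriorAlgebra.ι_sq_zero v
  rw [this, zero_mul]

lemma io_mul_swap (v w : V) (x : ExteriorAlgebra F V) :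
    io (F := F) v * (io w * x) = - (io w * (io v * x)) := by
  have h := io_mul_self (F := F) (v + w) x
  simp only [map_add, add_mul, mul_add, io_mul_self] at h
  rw [zero_add, add_zero] at h
  rw [eq_neg_iff_add_eq_zero, ← h, add_comm]

/-- Degree pieces with index shifted by `2`. -/
def L (F : Type*) [Field F] (V : Type*) [AddCommGroup V] [Module F V] :
    ℕ → Submodule F (ExteriorAlgebra F V)
  | 0 => ⊥
  | 1 => ⊥
  | (k + 2) => LinearMap.range (io : V →ₗ[F] ExteriorAlgebra F V) ^ k

lemma io_mul_mem (v : V) (κ : ℕ) (x : ExteriorAlgebra F V) (hx : x ∈ L F V κ) :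
    io v * x ∈ L F V (κ + 1) := by
  match κ, hx with
  | 0, hx => 
    have : x = 0 := hx
    subst this; simp
  | 1, hx =>
    have : x = 0 := hx
    subst this; simp
  | (k + 2), hx =>
    show io v * x ∈ LinearMap.range (io : V →ₗ[F] ExteriorAlgebra F V) ^ (k + 1)
    rw [pow_succ']
    exact Submodule.mul_mem_mul ⟨v, rfl⟩ hx

lemma ct_mem_aux (δ : Dual F V) (k : ℕ) : ∀ x ∈ L F V (k + 2), ct δ x ∈ L F V (k + 1) := by
  induction k with
  | zero =>
    intro x hx
    have hx' : x ∈ (1 : Submodule F (ExteriorAlgebra F V)) := by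
      simpa [L] using hx
    obtain ⟨a, rfl⟩ := Submodule.mem_one.1 hx'
    rw [ct_algebraMap]; exact zero_mem _
  | succ k ih =>
    intro x hx
    have hx' : x ∈ LinearMap.range (io : V →ₗ[F] ExteriorAlgebra F V) * L F V (k + 2) := by
      have : L F V (k + 1 + 2) =
        LinearMap.range (io : V →ₗ[F] ExteriorAlgebra F V) * L F V (k + 2) := pow_succ' _ _
      rwa [this] at hx
    refine Submodule.mul_induction_on hx' ?_ ?_
    · rintro _ ⟨v, rfl⟩ y hy
      rw [ct_io_mul]
      exact sub_mem (Submodule.smul_mem _ _ hy) (io_mul_mem v _ _ (ih y hy))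
    · intro a b ha hb
      rw [map_add]; exact add_mem ha hb

lemma ct_mem (δ : Dual F V) (κ : ℕ) (x : ExteriorAlgebra F V) (hx : x ∈ L F V (κ + 1)) :
    ct δ x ∈ L F V κ := by
  match κ, hx with
  | 0, hx =>
    have : x = 0 := hx
    subst this; simp
  | (k + 1), hx => exact ct_mem_aux δ k x hx

variable (α β : ℕ → Dual F V)

/-- The elementary contraction by a pair. -/
def pp (i : ℕ) : ExteriorAlgebra F V →ₗ[F] ExteriorAlgebra F V := ct (β i) ∘ₗ ct (α i)

lemma pp_apply (i : ℕ) (x : ExteriorAlgebra F V) : pp α β i x = ct (β i) (ct (α i) x) := rfl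

/-- Divided powers of the contraction by the form. -/
def DD : ℕ → ℕ → (ExteriorAlgebra F V →ₗ[F] ExteriorAlgebra F V)
  | _, 0 => LinearMap.id
  | 0, (_ + 1) => 0
  | (m + 1), (j + 1) => DD m (j + 1) + pp α β m ∘ₗ DD m j

lemma DD_zero (m : ℕ) (x : ExteriorAlgebra F V) : DD α β m 0 x = x := by
  cases m <;> rfl

lemma DD_zero_succ (j : ℕ) (x : ExteriorAlgebra F V) : DD α β 0 (j + 1) x = 0 := rfl

lemma DD_succ (m j : ℕ) (x : ExteriorAlgebra F V) :
    DD α β (m + 1) (j + 1) x = DD α β m (j + 1) x + pp α β m (DD α β m j x) := rfl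

lemma pp_ct (i : ℕ) (δ : Dual F V) (x : ExteriorAlgebra F V) :
    pp α β i (ct δ x) = ct δ (pp α β i x) := by
  rw [pp_apply, pp_apply, ct_comm (α i) δ, map_neg, ct_comm (β i) δ, neg_neg]

lemma DD_ct (m j : ℕ) (δ : Dual F V) (x : ExteriorAlgebra F V) :
    DD α β m j (ct δ x) = ct δ (DD α β m j x) := by
  induction m generalizing j with
  | zero => cases j with
    | zero => rw [DD_zero, DD_zero]
    | succ j => rw [DD_zero_succ, DD_zero_succ, map_zero]
  | succ m ih => cases j with
    | zero => rw [DD_zero, DD_zero]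
    | succ j => rw [DD_succ, DD_succ, ih, ih, pp_ct, map_add]

lemma DD_pp (m j i : ℕ) (x : ExteriorAlgebra F V) :
    DD α β m j (pp α β i x) = pp α β i (DD α β m j x) := by
  rw [pp_apply, DD_ct, DD_ct, pp_apply]

/-- The linear form `s(v, ·)` truncated to the first `m` pairs. -/
def CC (m : ℕ) (v : V) : Dual F V :=
  ∑ i ∈ Finset.range m, (α i v • β i - β i v • α i)

lemma CC_succ (m : ℕ) (v : V) :
    CC α β (m + 1) v = CC α β m v + (α m v • β m - β m v • α m) := Finset.sum_range_succ _ _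

lemma pp_io_mul (i : ℕ) (v : V) (x : ExteriorAlgebra F V) :
    pp α β i (io v * x) = io v * pp α β i x + ct (α i v • β i - β i v • α i) x := by
  rw [pp_apply, ct_io_mul, map_sub, map_smul, ct_io_mul, pp_apply, ct_sub, ct_smul, ct_smul]
  abel

lemma ct_pp_zero (i : ℕ) (a b : F) (x : ExteriorAlgebra F V) :
    ct (a • β i - b • α i) (pp α β i x) = 0 := by
  rw [ct_sub, ct_smul, ct_smul, pp_apply, ct_ct, ct_comm (α i), ct_ct]
  simp

lemma DD_io_mul (m j : ℕ) (v : V) (x : ExteriorAlgebra F V) :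
    DD α β m (j + 1) (io v * x) =
      io v * DD α β m (j + 1) x + ct (CC α β m v) (DD α β m j x) := by
  induction m generalizing j with
  | zero => 
    rw [DD_zero_succ, DD_zero_succ]
    simp [CC, ct_zero]
  | succ m ih => 
    rw [DD_succ, DD_succ, ih, CC_succ, ct_add]
    cases j with
    | zero =>
      rw [DD_zero, DD_zero, DD_zero, pp_io_mul, mul_add]
      abel
    | succ j =>
      rw [ih, map_add, pp_io_mul, DD_succ α β m j x, map_add, map_add, ct_pp_zero, mul_add, pp_ct]
      abel

lemma DD_io_mul' (m j : ℕ) (v : V) (hv : CC α β m v = 0) (x : ExteriorAlgebra F V) :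
    DD α β m j (io v * x) = io v * DD α β m j x := by
  cases j with
  | zero => rw [DD_zero, DD_zero]
  | succ j => rw [DD_io_mul, hv, ct_zero, add_zero]

/-- wedge of a tuple -/
lemma ct_wedge (k : ℕ) (v : Fin k → V) (δ : Dual F V) (h : ∀ t, δ (v t) = 0) :
    ct δ (ExteriorAlgebra.ιMulti F k v) = 0 := by
  induction k with
  | zero => rw [ExteriorAlgebra.ιMulti_zero_apply, ct_one]
  | succ k ih =>
    rw [ExteriorAlgebra.ιMulti_succ_apply]
    have := ct_io_mul δ (v 0) (ExteriorAlgebra.ιMulti F k (Matrix.vecTail v))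
    rw [ih (Matrix.vecTail v) (fun t => h _), h, mul_zero, zero_smul, sub_zero] at this
    exact this

lemma DD_wedge (m : ℕ) (k : ℕ) (v : Fin k → V) (h : ∀ a b, CC α β m (v a) (v b) = 0) (j : ℕ) :
    DD α β m (j + 1) (ExteriorAlgebra.ιMulti F k v) = 0 := by
  induction k generalizing j with
  | zero =>
    rw [ExteriorAlgebra.ιMulti_zero_apply]
    clear h
    induction m generalizing j with
    | zero => rfl
    | succ m ih =>
      rw [DD_succ, ih, zero_add, ← DD_pp, pp_apply, ct_one, map_zero, map_zero]
  | succ k ih =>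
    rw [ExteriorAlgebra.ιMulti_succ_apply]
    have h1 := DD_io_mul α β m j (v 0) (ExteriorAlgebra.ιMulti F k (Matrix.vecTail v))
    rw [ih (Matrix.vecTail v) (fun a b => h _ _), mul_zero, zero_add, ← DD_ct, ct_wedge k (Matrix.vecTail v) _ (fun t => h _ _),
      map_zero] at h1
    exact h1

lemma wedge_mem (k : ℕ) (v : Fin k → V) : ExteriorAlgebra.ιMulti F k v ∈ L F V (k + 2) :=
  ExteriorAlgebra.ιMulti_range F k ⟨v, rfl⟩

lemma wedge_cons (k : ℕ) (u : V) (v : Fin k → V) :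
    ExteriorAlgebra.ιMulti F (k + 1) (Matrix.vecCons u v) =
      io u * ExteriorAlgebra.ιMulti F k v := by
  rw [ExteriorAlgebra.ιMulti_succ_apply]
  rfl

end Ops

section Main

variable {F : Type*} [Field F] {V : Type*} [AddCommGroup V] [Module F V]

/-- Symplectic coordinates on `V`. -/
structure Setup (n d : ℕ) (B : V →ₗ[F] Dual F V) (e f r : ℕ → V)
    (α β ρ : ℕ → Dual F V) : Prop where
  alt : ∀ x, B x x = 0
  hα : ∀ i, B (f i) = - α i
  hβ : ∀ i, B (e i) = β i
  hr : ∀ i, B (r i) = 0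
  αe : ∀ i, i < n → α i (e i) = 1
  αe' : ∀ i j, i ≠ j → α i (e j) = 0
  αf : ∀ i j, α i (f j) = 0
  βf : ∀ i, i < n → β i (f i) = 1
  βf' : ∀ i j, i ≠ j → β i (f j) = 0
  βe : ∀ i j, β i (e j) = 0
  αr : ∀ i j, α i (r j) = 0
  βr : ∀ i j, β i (r j) = 0
  ρe : ∀ i j, ρ i (e j) = 0
  ρf : ∀ i j, ρ i (f j) = 0
  ρr : ∀ i, i < d → ρ i (r i) = 1
  ρr' : ∀ i j, i ≠ j → ρ i (r j) = 0
  αz : ∀ i, n ≤ i → α i = 0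
  βz : ∀ i, n ≤ i → β i = 0
  ρz : ∀ i, d ≤ i → ρ i = 0
  expand : ∀ v, v = ∑ i ∈ Finset.range n, (α i v • e i + β i v • f i)
    + ∑ j ∈ Finset.range d, ρ j v • r j

/-- The candidate for the Grassmann image. -/
def KK (α β ρ : ℕ → Dual F V) (m t q κ : ℕ) : Submodule F (ExteriorAlgebra F V) where
  carrier := {x | x ∈ L F V κ ∧ (∀ i, m ≤ i → ct (α i) x = 0 ∧ ct (β i) x = 0) ∧
    (∀ j, t ≤ j → ct (ρ j) x = 0) ∧ ∀ j, q ≤ j → DD α β m j x = 0}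
  zero_mem' := by simp
  add_mem' := by
    rintro x y ⟨hx1, hx2, hx3, hx4⟩ ⟨hy1, hy2, hy3, hy4⟩
    refine ⟨add_mem hx1 hy1, fun i hi => ⟨?_, ?_⟩, fun i hi => ?_, fun i hi => ?_⟩
    · rw [map_add, (hx2 i hi).1, (hy2 i hi).1, add_zero]
    · rw [map_add, (hx2 i hi).2, (hy2 i hi).2, add_zero]
    · rw [map_add, hx3 i hi, hy3 i hi, add_zero]
    · rw [map_add, hx4 i hi, hy4 i hi, add_zero]
  smul_mem' := by
    rintro a x ⟨hx1, hx2, hx3, hx4⟩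
    refine ⟨Submodule.smul_mem _ _ hx1, fun i hi => ⟨?_, ?_⟩, fun i hi => ?_, fun i hi => ?_⟩
    · rw [map_smul, (hx2 i hi).1, smul_zero]
    · rw [map_smul, (hx2 i hi).2, smul_zero]
    · rw [map_smul, hx3 i hi, smul_zero]
    · rw [map_smul, hx4 i hi, smul_zero]

variable {n d : ℕ} {B : V →ₗ[F] Dual F V} {e f r : ℕ → V} {α β ρ : ℕ → Dual F V}

lemma CC_e (S : Setup n d B e f r α β ρ) (m i : ℕ) (h : m ≤ i) : CC α β m (e i) = 0 := by
  refine Finset.sum_eq_zero fun j hj => ?_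
  have := Finset.mem_range.1 hj
  rw [S.αe' j i (by omega), S.βe]; simp

lemma CC_f (S : Setup n d B e f r α β ρ) (m i : ℕ) (h : m ≤ i) : CC α β m (f i) = 0 := by
  refine Finset.sum_eq_zero fun j hj => ?_
  have := Finset.mem_range.1 hj
  rw [S.βf' j i (by omega), S.αf]; simp

lemma CC_r (S : Setup n d B e f r α β ρ) (m i : ℕ) : CC α β m (r i) = 0 := by
  refine Finset.sum_eq_zero fun j hj => ?_
  rw [S.αr, S.βr]; simp

lemma CC_n (S : Setup n d B e f r α β ρ) (v : V) : CC α β n v = B v := by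
  conv_rhs => rw [S.expand v]
  simp only [map_add, map_sum, map_smul, S.hα, S.hβ, S.hr, smul_zero, Finset.sum_const_zero,
    add_zero, CC]
  refine Finset.sum_congr rfl fun i _ => ?_
  rw [smul_neg, sub_eq_add_neg]

lemma CC_m (S : Setup n d B e f r α β ρ) (m : ℕ) (hm : m ≤ n) (v : V)
    (hv : ∀ i, m ≤ i → α i v = 0 ∧ β i v = 0) : CC α β m v = B v := by
  rw [← CC_n S]
  refine Finset.sum_subset (Finset.range_subset_range.2 hm) fun i _ hi => ?_
  have : m ≤ i := by simpa using hi
  rw [(hv i this).1, (hv i this).2]; simp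

/-- pair projections -/
lemma io_e_mem (S : Setup n d B e f r α β ρ) (m t κ : ℕ) (hm : m < n)
    (y : ExteriorAlgebra F V) (hy : y ∈ KK α β ρ m t 1 κ) :
    io (e m) * y ∈ KK α β ρ (m + 1) t 1 (κ + 1) ∧ ct (α m) (io (e m) * y) = y ∧
      ct (β m) (io (e m) * y) = 0 := by
  obtain ⟨h1, h2, h3, h4⟩ := hy
  have ha : ct (α m) (io (e m) * y) = y := by
    rw [ct_io_mul, S.αe m hm, (h2 m le_rfl).1]; simp
  have hb : ct (β m) (io (e m) * y) = 0 := by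
    rw [ct_io_mul, S.βe, (h2 m le_rfl).2]; simp
  refine ⟨⟨io_mul_mem _ _ _ h1, fun i hi => ⟨?_, ?_⟩, fun i hi => ?_, fun i hi => ?_⟩, ha, hb⟩
  · rw [ct_io_mul, S.αe' i m (by omega), (h2 i (by omega)).1]; simp
  · rw [ct_io_mul, S.βe, (h2 i (by omega)).2]; simp
  · rw [ct_io_mul, S.ρe, h3 i hi]; simp
  · obtain ⟨j, rfl⟩ : ∃ j, i = j + 1 := ⟨i - 1, by omega⟩
    rw [DD_succ, DD_io_mul' _ _ _ _ _ (CC_e S m m le_rfl), h4 _ hi, ← DD_pp, pp_apply, ha,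
      (h2 m le_rfl).2]
    simp

lemma io_f_mem (S : Setup n d B e f r α β ρ) (m t κ : ℕ) (hm : m < n)
    (y : ExteriorAlgebra F V) (hy : y ∈ KK α β ρ m t 1 κ) :
    io (f m) * y ∈ KK α β ρ (m + 1) t 1 (κ + 1) ∧ ct (α m) (io (f m) * y) = 0 ∧
      ct (β m) (io (f m) * y) = y := by
  obtain ⟨h1, h2, h3, h4⟩ := hy
  have ha : ct (α m) (io (f m) * y) = 0 := by
    rw [ct_io_mul, S.αf, (h2 m le_rfl).1]; simp
  have hb : ct (β m) (io (f m) * y) = y := by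
    rw [ct_io_mul, S.βf m hm, (h2 m le_rfl).2]; simp
  refine ⟨⟨io_mul_mem _ _ _ h1, fun i hi => ⟨?_, ?_⟩, fun i hi => ?_, fun i hi => ?_⟩, ha, hb⟩
  · rw [ct_io_mul, S.αf, (h2 i (by omega)).1]; simp
  · rw [ct_io_mul, S.βf' i m (by omega), (h2 i (by omega)).2]; simp
  · rw [ct_io_mul, S.ρf, h3 i hi]; simp
  · obtain ⟨j, rfl⟩ : ∃ j, i = j + 1 := ⟨i - 1, by omega⟩
    rw [DD_succ, DD_io_mul' _ _ _ _ _ (CC_f S m m le_rfl), h4 _ hi, ← DD_pp, pp_apply, ha]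
    simp

lemma io_r_mem (S : Setup n d B e f r α β ρ) (m t κ : ℕ) (ht : t < d)
    (y : ExteriorAlgebra F V) (hy : y ∈ KK α β ρ m t 1 κ) :
    io (r t) * y ∈ KK α β ρ m (t + 1) 1 (κ + 1) ∧ ct (ρ t) (io (r t) * y) = y := by
  obtain ⟨h1, h2, h3, h4⟩ := hy
  have ha : ct (ρ t) (io (r t) * y) = y := by
    rw [ct_io_mul, S.ρr t ht, (h3 t le_rfl)]; simp
  refine ⟨⟨io_mul_mem _ _ _ h1, fun i hi => ⟨?_, ?_⟩, fun i hi => ?_, fun i hi => ?_⟩, ha⟩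
  · rw [ct_io_mul, S.αr, (h2 i (by omega)).1]; simp
  · rw [ct_io_mul, S.βr, (h2 i (by omega)).2]; simp
  · rw [ct_io_mul, S.ρr' i t (by omega), h3 i (by omega)]; simp
  · rw [DD_io_mul' _ _ _ _ _ (CC_r S m t), h4 _ hi]
    simp

lemma ct_ρ_mem (m t κ : ℕ) (x : ExteriorAlgebra F V)
    (hx : x ∈ KK α β ρ m (t + 1) 1 (κ + 1)) : ct (ρ t) x ∈ KK α β ρ m t 1 κ := by
  obtain ⟨h1, h2, h3, h4⟩ := hx
  refine ⟨ct_mem _ _ _ h1, fun i hi => ⟨?_, ?_⟩, fun i hi => ?_, fun i hi => ?_⟩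
  · rw [ct_comm, (h2 i hi).1]; simp
  · rw [ct_comm, (h2 i hi).2]; simp
  · rcases eq_or_lt_of_le hi with rfl | hi
    · exact ct_ct _ _
    · rw [ct_comm, h3 i hi]; simp
  · rw [DD_ct, h4 i hi, map_zero]

lemma KK_t_mono (m t κ : ℕ) : KK α β ρ m t 1 κ ≤ KK α β ρ m (t + 1) 1 κ := by
  rintro x ⟨h1, h2, h3, h4⟩
  exact ⟨h1, h2, fun j hj => h3 j (by omega), h4⟩

lemma KK_t_of (m t κ : ℕ) (x : ExteriorAlgebra F V) (hx : x ∈ KK α β ρ m (t + 1) 1 κ)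
    (h : ct (ρ t) x = 0) : x ∈ KK α β ρ m t 1 κ := by
  obtain ⟨h1, h2, h3, h4⟩ := hx
  refine ⟨h1, h2, fun j hj => ?_, h4⟩
  rcases eq_or_lt_of_le hj with rfl | hj
  · exact h
  · exact h3 j hj

lemma KK_m_mono (m t κ : ℕ) : KK α β ρ m t 1 κ ≤ KK α β ρ (m + 1) t 1 κ := by
  rintro x ⟨h1, h2, h3, h4⟩
  refine ⟨h1, fun j hj => h2 j (by omega), h3, fun i hi => ?_⟩
  obtain ⟨j, rfl⟩ : ∃ j, i = j + 1 := ⟨i - 1, by omega⟩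
  rw [DD_succ, h4 _ hi, ← DD_pp, pp_apply, (h2 m le_rfl).1]; simp

lemma KK_m_of (m t κ : ℕ) (x : ExteriorAlgebra F V) (hx : x ∈ KK α β ρ (m + 1) t 1 κ)
    (ha : ct (α m) x = 0) (hb : ct (β m) x = 0) : x ∈ KK α β ρ m t 1 κ := by
  obtain ⟨h1, h2, h3, h4⟩ := hx
  refine ⟨h1, fun j hj => ?_, h3, fun i hi => ?_⟩
  · rcases eq_or_lt_of_le hj with rfl | hj
    · exact ⟨ha, hb⟩
    · exact h2 j hj
  · obtain ⟨j, rfl⟩ : ∃ j, i = j + 1 := ⟨i - 1, by omega⟩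
    have := h4 _ hi
    rwa [DD_succ, ← DD_pp, pp_apply, ha, map_zero, map_zero, add_zero] at this

/-- contraction by any form killing `pp` -/
lemma ct_α_mem (m t κ : ℕ) (x : ExteriorAlgebra F V)
    (hx : x ∈ KK α β ρ (m + 1) t 1 (κ + 1)) (h : ct (β m) (ct (α m) x) = 0) :
    ct (α m) x ∈ KK α β ρ m t 1 κ := by
  obtain ⟨h1, h2, h3, h4⟩ := hx
  refine ⟨ct_mem _ _ _ h1, fun i hi => ?_, fun i hi => ?_, fun i hi => ?_⟩
  · rcases eq_or_lt_of_le hi with rfl | hi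
    · exact ⟨ct_ct _ _, h⟩
    · constructor
      · rw [ct_comm, (h2 i hi).1]; simp
      · rw [ct_comm, (h2 i hi).2]; simp
  · rw [ct_comm, h3 i hi]; simp
  · obtain ⟨j, rfl⟩ : ∃ j, i = j + 1 := ⟨i - 1, by omega⟩
    have := h4 _ hi
    rw [DD_succ, ← DD_pp, pp_apply, h, map_zero, add_zero] at this
    rw [DD_ct, this, map_zero]

lemma ct_β_mem (m t κ : ℕ) (x : ExteriorAlgebra F V)
    (hx : x ∈ KK α β ρ (m + 1) t 1 (κ + 1)) (h : ct (β m) (ct (α m) x) = 0) :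
    ct (β m) x ∈ KK α β ρ m t 1 κ := by
  obtain ⟨h1, h2, h3, h4⟩ := hx
  refine ⟨ct_mem _ _ _ h1, fun i hi => ?_, fun i hi => ?_, fun i hi => ?_⟩
  · rcases eq_or_lt_of_le hi with rfl | hi
    · exact ⟨by rw [ct_comm, h, neg_zero], ct_ct _ _⟩
    · constructor
      · rw [ct_comm, (h2 i hi).1]; simp
      · rw [ct_comm, (h2 i hi).2]; simp
  · rw [ct_comm, h3 i hi]; simp
  · obtain ⟨j, rfl⟩ : ∃ j, i = j + 1 := ⟨i - 1, by omega⟩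
    have := h4 _ hi
    rw [DD_succ, ← DD_pp, pp_apply, h, map_zero, add_zero] at this
    rw [DD_ct, this, map_zero]

lemma pp_pp (m : ℕ) (x : ExteriorAlgebra F V) : pp α β m (pp α β m x) = 0 := by
  rw [pp_apply, pp_apply, ct_comm (α m), ct_ct]; simp

lemma pp_mem (m t κ : ℕ) (x : ExteriorAlgebra F V)
    (hx : x ∈ KK α β ρ (m + 1) t 1 (κ + 2)) : pp α β m x ∈ KK α β ρ m t 1 κ := by
  obtain ⟨h1, h2, h3, h4⟩ := hx
  refine ⟨ct_mem _ _ _ (ct_mem _ _ _ h1), fun i hi => ?_, fun i hi => ?_, fun i hi => ?_⟩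
  · rcases eq_or_lt_of_le hi with rfl | hi
    · constructor
      · rw [pp_apply, ct_comm, ct_ct, map_zero, neg_zero]
      · rw [pp_apply, ct_ct]
    · rw [← pp_ct, ← pp_ct, (h2 i hi).1, (h2 i hi).2]; simp
  · rw [← pp_ct, h3 i hi]; simp
  · obtain ⟨j, rfl⟩ : ∃ j, i = j + 1 := ⟨i - 1, by omega⟩
    have := congrArg (pp α β m) (h4 _ hi)
    rw [DD_succ, map_add, pp_pp, add_zero, map_zero] at this
    rw [DD_pp, this]


/-- projection along a vector -/
def pr (δ : Dual F V) (u : V) (y : ExteriorAlgebra F V) : ExteriorAlgebra F V :=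
  y - io u * ct δ y

lemma pr_mem (δ : Dual F V) (u : V) (κ : ℕ) (y : ExteriorAlgebra F V) (hy : y ∈ L F V (κ + 1)) :
    pr δ u y ∈ L F V (κ + 1) :=
  sub_mem hy (io_mul_mem _ _ _ (ct_mem _ _ _ hy))

lemma ct_pr_self (δ : Dual F V) (u : V) (h : δ u = 1) (y : ExteriorAlgebra F V) :
    ct δ (pr δ u y) = 0 := by
  rw [pr, map_sub, ct_io_mul, h, ct_ct]; simp

lemma ct_pr (δ δ' : Dual F V) (u : V) (h : δ' u = 0) (y : ExteriorAlgebra F V)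
    (hy : ct δ' y = 0) : ct δ' (pr δ u y) = 0 := by
  rw [pr, map_sub, ct_io_mul, h, hy, ct_comm, hy]; simp

lemma DD_pr (m j : ℕ) (δ : Dual F V) (u : V) (h : CC α β m u = 0) (y : ExteriorAlgebra F V) :
    DD α β m j (pr δ u y) = pr δ u (DD α β m j y) := by
  rw [pr, map_sub, DD_io_mul' _ _ _ _ _ h, DD_ct, pr]

lemma pr_zero (δ : Dual F V) (u : V) : pr δ u (0 : ExteriorAlgebra F V) = 0 := by
  simp [pr]

/-- ideal part generated by a subspace of vectors -/
def II (U : Set V) : Submodule F (ExteriorAlgebra F V) :=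
  Submodule.span F {x | ∃ v ∈ U, ∃ y, x = io v * y}

lemma II_step (U U' : Set V) (δ : Dual F V) (u : V) (h : ∀ v ∈ U, v - δ v • u ∈ U')
    (x : ExteriorAlgebra F V) (hx : x ∈ II (F := F) U) (h0 : ct δ x = 0) : x ∈ II (F := F) U' := by
  have key : ∀ x ∈ II (F := F) U, pr δ u x ∈ II (F := F) U' := by
    intro x hx
    refine Submodule.span_induction ?_ ?_ ?_ ?_ hx
    · rintro _ ⟨v, hv, y, rfl⟩
      refine Submodule.subset_span ⟨_, h v hv, pr δ u y, ?_⟩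
      simp only [pr, ct_io_mul, map_sub, map_smul, sub_mul, mul_sub, smul_mul_assoc,
        mul_smul_comm, io_mul_self, smul_zero]
      rw [io_mul_swap u v]
      abel
    · rw [pr_zero]; exact zero_mem _
    · intro a b _ _ ha hb
      have : pr δ u (a + b) = pr δ u a + pr δ u b := by
        simp only [pr, map_add, mul_add]; abel
      rw [this]; exact add_mem ha hb
    · intro c a _ ha
      have : pr δ u (c • a) = c • pr δ u a := by
        simp only [pr, map_smul, mul_smul_comm, smul_sub]
      rw [this]; exact Submodule.smul_mem _ _ ha
  have := key x hx
  rwa [pr, h0, mul_zero, sub_zero] at this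

lemma II_top (k : ℕ) (x : ExteriorAlgebra F V) (hx : x ∈ L F V (k + 3)) :
    x ∈ II (F := F) (Set.univ : Set V) := by
  have hx' : x ∈ LinearMap.range (io : V →ₗ[F] ExteriorAlgebra F V) * L F V (k + 2) := by
    have : L F V (k + 1 + 2) =
      LinearMap.range (io : V →ₗ[F] ExteriorAlgebra F V) * L F V (k + 2) := pow_succ' _ _
    rw [← this]; exact hx
  refine Submodule.mul_induction_on hx' ?_ fun _ _ => add_mem
  rintro _ ⟨v, rfl⟩ y _
  exact Submodule.subset_span ⟨v, Set.mem_univ _, y, rfl⟩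

lemma base_zero (S : Setup n d B e f r α β ρ) (k : ℕ) (x : ExteriorAlgebra F V)
    (hx : x ∈ L F V (k + 3)) (hα : ∀ i, ct (α i) x = 0) (hβ : ∀ i, ct (β i) x = 0)
    (hρ : ∀ i, ct (ρ i) x = 0) : x = 0 := by
  have h1 : ∀ i, i ≤ n → x ∈ II (F := F) {v : V | ∀ j < i, α j v = 0} := by
    intro i
    induction i with
    | zero => intro _; simpa using II_top k x hx
    | succ i ih =>
      intro hi
      refine II_step _ _ (α i) (e i) ?_ x (ih (by omega)) (hα i)
      intro v hv j hj
      rw [map_sub, map_smul]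
      rcases eq_or_ne j i with rfl | hji
      · rw [S.αe j (by omega)]; simp
      · rw [hv j (by omega), S.αe' j i hji]; simp
  have h2 : ∀ i, i ≤ n → x ∈ II (F := F)
      {v : V | (∀ j < n, α j v = 0) ∧ ∀ j < i, β j v = 0} := by
    intro i
    induction i with
    | zero => intro _; simpa using h1 n le_rfl
    | succ i ih =>
      intro hi
      refine II_step _ _ (β i) (f i) ?_ x (ih (by omega)) (hβ i)
      rintro v ⟨hv1, hv⟩
      refine ⟨fun j hj => ?_, fun j hj => ?_⟩
      · rw [map_sub, map_smul, hv1 j hj, S.αf]; simp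
      rw [map_sub, map_smul]
      rcases eq_or_ne j i with rfl | hji
      · rw [S.βf j (by omega)]; simp
      · rw [hv j (by omega), S.βf' j i hji]; simp
  have h3 : ∀ i, i ≤ d → x ∈ II (F := F)
      {v : V | (∀ j < n, α j v = 0) ∧ (∀ j < n, β j v = 0) ∧ ∀ j < i, ρ j v = 0} := by
    intro i
    induction i with
    | zero => intro _; simpa using h2 n le_rfl
    | succ i ih =>
      intro hi
      refine II_step _ _ (ρ i) (r i) ?_ x (ih (by omega)) (hρ i)
      rintro v ⟨hv1, hv2, hv⟩
      refine ⟨fun j hj => ?_, fun j hj => ?_, fun j hj => ?_⟩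
      · rw [map_sub, map_smul, hv1 j hj, S.αr]; simp
      · rw [map_sub, map_smul, hv2 j hj, S.βr]; simp
      rw [map_sub, map_smul]
      rcases eq_or_ne j i with rfl | hji
      · rw [S.ρr j (by omega)]; simp
      · rw [hv j (by omega), S.ρr' j i hji]; simp
  have h4 := h3 d le_rfl
  have h5 : II (F := F)
      {v : V | (∀ j < n, α j v = 0) ∧ (∀ j < n, β j v = 0) ∧ ∀ j < d, ρ j v = 0} ≤ ⊥ := by
    refine Submodule.span_le.2 ?_
    rintro _ ⟨v, ⟨a1, a2, a3⟩, y, rfl⟩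
    have : v = 0 := by
      rw [S.expand v, Finset.sum_eq_zero, Finset.sum_eq_zero, add_zero]
      · intro j hj; rw [a3 j (Finset.mem_range.1 hj), zero_smul]
      · intro j hj
        rw [a1 j (Finset.mem_range.1 hj), a2 j (Finset.mem_range.1 hj)]; simp
    subst this
    simp
  exact h5 h4

lemma vanish (S : Setup n d B e f r α β ρ) (m : ℕ) : m ≤ n → ∀ q κ x,
    x ∈ KK α β ρ m 0 q κ → m + q + 2 ≤ κ → x = 0 := by
  induction m with
  | zero =>
    rintro - q κ x ⟨h1, h2, h3, h4⟩ hκ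
    cases q with
    | zero => simpa [DD_zero] using h4 0 le_rfl
    | succ q =>
      obtain ⟨k, rfl⟩ : ∃ k, κ = k + 3 := ⟨κ - 3, by omega⟩
      exact base_zero S k x h1 (fun i => (h2 i (Nat.zero_le _)).1)
        (fun i => (h2 i (Nat.zero_le _)).2) (fun i => h3 i (Nat.zero_le _))
  | succ m ih =>
    rintro hm q κ x ⟨h1, h2, h3, h4⟩ hκ
    cases q with
    | zero => simpa [DD_zero] using h4 0 le_rfl
    | succ q =>
    obtain ⟨κ, rfl⟩ : ∃ k, κ = k + 2 := ⟨κ - 2, by omega⟩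
    have ih' := ih (by omega)
    have hce := CC_e S m m le_rfl
    have hcf := CC_f S m m le_rfl
    have E : ∀ i, q ≤ i → DD α β m (i + 1) x = - pp α β m (DD α β m i x) := by
      intro i hi
      have := h4 (i + 1) (by omega)
      rw [DD_succ] at this
      exact eq_neg_of_add_eq_zero_left this
    have H1 : ∀ j, q + 2 ≤ j → DD α β m j x = 0 := by
      intro j hj
      obtain ⟨i, rfl⟩ : ∃ i, j = i + 2 := ⟨j - 2, by omega⟩
      rw [E (i + 1) (by omega), E i (by omega), map_neg, pp_pp]; simp
    have H2 : ∀ j, q + 1 ≤ j → ct (α m) (DD α β m j x) = 0 := by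
      intro j hj
      obtain ⟨i, rfl⟩ : ∃ i, j = i + 1 := ⟨j - 1, by omega⟩
      rw [E i (by omega), map_neg, pp_apply, ct_comm (α m), ct_ct]; simp
    have H3 : ∀ j, q + 1 ≤ j → ct (β m) (DD α β m j x) = 0 := by
      intro j hj
      obtain ⟨i, rfl⟩ : ∃ i, j = i + 1 := ⟨j - 1, by omega⟩
      rw [E i (by omega), map_neg, pp_apply, ct_ct]; simp
    have ee1 := S.αe m (by omega)
    have ff1 := S.βf m (by omega)
    -- the component without `e`, `f`
    have x0 : pr (β m) (f m) (pr (α m) (e m) x) = 0 := by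
      refine ih' (q + 2) (κ + 2) _ ⟨pr_mem _ _ _ _ (pr_mem _ _ _ _ h1), fun i hi => ?_,
        fun i hi => ?_, fun j hj => ?_⟩ (by omega)
      · rcases eq_or_lt_of_le hi with rfl | hi
        · exact ⟨ct_pr _ _ _ (S.αf _ _) _ (ct_pr_self _ _ ee1 _), ct_pr_self _ _ ff1 _⟩
        · exact ⟨ct_pr _ _ _ (S.αf _ _) _ (ct_pr _ _ _ (S.αe' _ _ (by omega)) _ (h2 i hi).1),
            ct_pr _ _ _ (S.βf' _ _ (by omega)) _ (ct_pr _ _ _ (S.βe _ _) _ (h2 i hi).2)⟩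
      · exact ct_pr _ _ _ (S.ρf _ _) _ (ct_pr _ _ _ (S.ρe _ _) _ (h3 i hi))
      · rw [DD_pr _ _ _ _ hcf, DD_pr _ _ _ _ hce, H1 j hj, pr_zero, pr_zero]
    have x1 : pr (β m) (f m) (ct (α m) x) = 0 := by
      refine ih' (q + 1) (κ + 1) _ ⟨pr_mem _ _ _ _ (ct_mem _ _ _ h1), fun i hi => ?_,
        fun i hi => ?_, fun j hj => ?_⟩ (by omega)
      · rcases eq_or_lt_of_le hi with rfl | hi
        · exact ⟨ct_pr _ _ _ (S.αf _ _) _ (ct_ct _ _), ct_pr_self _ _ ff1 _⟩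
        · exact ⟨ct_pr _ _ _ (S.αf _ _) _ (by rw [ct_comm, (h2 i hi).1]; simp),
            ct_pr _ _ _ (S.βf' _ _ (by omega)) _ (by rw [ct_comm, (h2 i hi).2]; simp)⟩
      · exact ct_pr _ _ _ (S.ρf _ _) _ (by rw [ct_comm, h3 i hi]; simp)
      · rw [DD_pr _ _ _ _ hcf, DD_ct, H2 j hj, pr_zero]
    have x2 : pr (α m) (e m) (ct (β m) x) = 0 := by
      refine ih' (q + 1) (κ + 1) _ ⟨pr_mem _ _ _ _ (ct_mem _ _ _ h1), fun i hi => ?_,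
        fun i hi => ?_, fun j hj => ?_⟩ (by omega)
      · rcases eq_or_lt_of_le hi with rfl | hi
        · exact ⟨ct_pr_self _ _ ee1 _, ct_pr _ _ _ (S.βe _ _) _ (ct_ct _ _)⟩
        · exact ⟨ct_pr _ _ _ (S.αe' _ _ (by omega)) _ (by rw [ct_comm, (h2 i hi).1]; simp),
            ct_pr _ _ _ (S.βe _ _) _ (by rw [ct_comm, (h2 i hi).2]; simp)⟩
      · exact ct_pr _ _ _ (S.ρe _ _) _ (by rw [ct_comm, h3 i hi]; simp)
      · rw [DD_pr _ _ _ _ hce, DD_ct, H3 j hj, pr_zero]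
    have e1 : ct (α m) x = io (f m) * pp α β m x := sub_eq_zero.1 x1
    have e2 : ct (β m) x = - (io (e m) * pp α β m x) := by
      have := sub_eq_zero.1 x2
      rw [this, ct_comm, pp_apply, mul_neg]
    have e0 : x = io (e m) * (io (f m) * pp α β m x) := by
      have h := sub_eq_zero.1 x0
      have h' : ct (β m) (pr (α m) (e m) x) = 0 := by
        rw [pr, map_sub, ct_io_mul, S.βe, e2, ← pp_apply]; simp
      rw [h', mul_zero, pr, e1] at h
      exact sub_eq_zero.1 h
    have ka : ct (α m) (pp α β m x) = 0 := by rw [pp_apply, ct_comm, ct_ct]; simp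
    have kb : ct (β m) (pp α β m x) = 0 := by rw [pp_apply, ct_ct]
    have x3 : pp α β m x = 0 := by
      refine ih' q κ _ ⟨ct_mem _ _ _ (ct_mem _ _ _ h1), fun i hi => ?_,
        fun i hi => ?_, fun j hj => ?_⟩ (by omega)
      · rcases eq_or_lt_of_le hi with rfl | hi
        · exact ⟨ka, kb⟩
        · rw [← pp_ct, ← pp_ct, (h2 i hi).1, (h2 i hi).2]; simp
      · rw [← pp_ct, h3 i hi]; simp
      · have h5 := E j hj
        have h6 : DD α β m (j + 1) x = 0 := by
          rw [e0, DD_io_mul' _ _ _ _ _ hce, DD_io_mul' _ _ _ _ _ hcf, DD_pp, E j hj, map_neg,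
            pp_pp]
          simp
        rw [h6] at h5
        rw [DD_pp]
        exact (neg_eq_zero.1 h5.symm)
    rw [e0, x3]; simp


/-- wedges of pairwise orthogonal vectors all satisfying `P` -/
def TP (B : V →ₗ[F] Dual F V) (k : ℕ) (P : V → Prop) (w : ExteriorAlgebra F V) : Prop :=
  ∃ v : Fin k → V, (∀ a, P (v a)) ∧ (∀ a b, B (v a) (v b) = 0) ∧ w = ExteriorAlgebra.ιMulti F k v

/-- vectors with vanishing coordinates -/
def Pm (α β ρ : ℕ → Dual F V) (m : ℕ) (J : Finset ℕ) (y : V) : Prop :=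
  (∀ i, i ∈ J ∨ m ≤ i → α i y = 0 ∧ β i y = 0) ∧ ∀ j, ρ j y = 0

/-- special generators -/
def TT (B : V →ₗ[F] Dual F V) (α β ρ : ℕ → Dual F V) (m κ : ℕ) : Set (ExteriorAlgebra F V) :=
  {w | ∃ (k : ℕ) (J : Finset ℕ), κ = k + 2 ∧ J ⊆ Finset.range m ∧ J.card + k = m ∧
    TP B k (Pm α β ρ m J) w}

lemma TP_mono (k : ℕ) (P P' : V → Prop) (h : ∀ y, P y → P' y) (w : ExteriorAlgebra F V)
    (hw : TP B k P w) : TP B k P' w := by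
  obtain ⟨v, h1, h2, h3⟩ := hw
  exact ⟨v, fun a => h _ (h1 a), h2, h3⟩

lemma B_symm (halt : ∀ x, B x x = 0) (x y : V) (h : B x y = 0) : B y x = 0 := by
  have := halt (x + y)
  simp only [map_add, LinearMap.add_apply, halt, h] at this
  simpa using this

lemma TP_cons (halt : ∀ x, B x x = 0) (k : ℕ) (P P' : V → Prop) (h : ∀ y, P y → P' y) (u : V)
    (hu : P' u) (hB : ∀ y, P y → B u y = 0) (w : ExteriorAlgebra F V) (hw : TP B k P w) :
    TP B (k + 1) P' (io u * w) := by
  obtain ⟨v, h1, h2, rfl⟩ := hw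
  refine ⟨Matrix.vecCons u v, ?_, ?_, (wedge_cons k u v).symm⟩
  · intro a
    refine Fin.cases hu (fun a => ?_) a
    exact h _ (h1 a)
  · intro a b
    refine Fin.cases ?_ (fun a => ?_) a
    · refine Fin.cases (halt u) (fun b => ?_) b
      exact hB _ (h1 b)
    · refine Fin.cases ?_ (fun b => ?_) b
      · exact B_symm halt _ _ (hB _ (h1 a))
      · exact h2 a b

lemma TT_le (S : Setup n d B e f r α β ρ) (m κ : ℕ) (hm : m ≤ n) (w : ExteriorAlgebra F V)
    (hw : w ∈ TT B α β ρ m κ) : w ∈ KK α β ρ m 0 1 κ := by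
  obtain ⟨k, J, rfl, hJ, hc, v, h1, h2, rfl⟩ := hw
  refine ⟨wedge_mem k v, fun i hi => ⟨ct_wedge k v _ fun a => ((h1 a).1 i (Or.inr hi)).1,
    ct_wedge k v _ fun a => ((h1 a).1 i (Or.inr hi)).2⟩,
    fun i _ => ct_wedge k v _ fun a => (h1 a).2 i, fun j hj => ?_⟩
  obtain ⟨j, rfl⟩ : ∃ i, j = i + 1 := ⟨j - 1, by omega⟩
  refine DD_wedge α β m k v (fun a b => ?_) j
  rw [CC_m S m hm _ fun i hi => (h1 a).1 i (Or.inr hi)]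
  exact h2 a b

lemma TT_mono (m κ : ℕ) : TT B α β ρ m κ ⊆ TT B α β ρ (m + 1) κ := by
  rintro w ⟨k, J, rfl, hJ, hc, hw⟩
  have hmJ : m ∉ J := fun h => by simpa using hJ h
  refine ⟨k, insert m J, rfl, ?_, ?_, TP_mono _ _ _ ?_ _ hw⟩
  · intro i hi
    rcases Finset.mem_insert.1 hi with rfl | hi
    · simp
    · have := Finset.mem_range.1 (hJ hi); simp; omega
  · rw [Finset.card_insert_of_notMem hmJ]; omega
  · rintro y ⟨h1, h2⟩
    refine ⟨fun i hi => h1 i ?_, h2⟩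
    rcases hi with hi | hi
    · rcases Finset.mem_insert.1 hi with rfl | hi
      · right; exact le_rfl
      · left; exact hi
    · right; omega

lemma TT_e (S : Setup n d B e f r α β ρ) (m κ : ℕ) (w : ExteriorAlgebra F V)
    (hw : w ∈ TT B α β ρ m κ) : io (e m) * w ∈ TT B α β ρ (m + 1) (κ + 1) := by
  obtain ⟨k, J, rfl, hJ, hc, hw⟩ := hw
  refine ⟨k + 1, J, rfl, hJ.trans (Finset.range_subset_range.2 (by omega)), by omega,
    TP_cons S.alt k _ _ ?_ _ ?_ ?_ _ hw⟩
  · rintro y ⟨h1, h2⟩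
    exact ⟨fun i hi => h1 i (hi.imp id Nat.le_of_succ_le), h2⟩
  · refine ⟨fun i hi => ⟨S.αe' _ _ ?_, S.βe _ _⟩, fun j => S.ρe _ _⟩
    rcases hi with hi | hi
    · have := Finset.mem_range.1 (hJ hi); omega
    · omega
  · rintro y ⟨h1, h2⟩
    rw [S.hβ]; exact (h1 m (Or.inr le_rfl)).2

lemma TT_f (S : Setup n d B e f r α β ρ) (m κ : ℕ) (w : ExteriorAlgebra F V)
    (hw : w ∈ TT B α β ρ m κ) : io (f m) * w ∈ TT B α β ρ (m + 1) (κ + 1) := by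
  obtain ⟨k, J, rfl, hJ, hc, hw⟩ := hw
  refine ⟨k + 1, J, rfl, hJ.trans (Finset.range_subset_range.2 (by omega)), by omega,
    TP_cons S.alt k _ _ ?_ _ ?_ ?_ _ hw⟩
  · rintro y ⟨h1, h2⟩
    exact ⟨fun i hi => h1 i (hi.imp id Nat.le_of_succ_le), h2⟩
  · refine ⟨fun i hi => ⟨S.αf _ _, S.βf' _ _ ?_⟩, fun j => S.ρf _ _⟩
    rcases hi with hi | hi
    · have := Finset.mem_range.1 (hJ hi); omega
    · omega
  · rintro y ⟨h1, h2⟩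
    rw [S.hα, LinearMap.neg_apply, (h1 m (Or.inr le_rfl)).1, neg_zero]

lemma TT_lift (S : Setup n d B e f r α β ρ) (m κ : ℕ) (hm : m < n) (hκ : κ ≤ m + 1)
    (w : ExteriorAlgebra F V) (hw : w ∈ TT B α β ρ m κ) :
    ∃ y ∈ TT B α β ρ (m + 1) (κ + 2), pp α β m y = w := by
  have hK := TT_le S m κ (by omega) w hw
  obtain ⟨k, J, rfl, hJ, hc, hw⟩ := hw
  obtain ⟨i, hi⟩ : J.Nonempty := by
    rw [← Finset.card_pos]; omega
  have him : i < m := Finset.mem_range.1 (hJ hi)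
  refine ⟨io (e m + f i) * (io (f m + e i) * w), ⟨k + 2, J.erase i, rfl, ?_, ?_, ?_⟩, ?_⟩
  · exact (Finset.erase_subset _ _).trans (hJ.trans (Finset.range_subset_range.2 (by omega)))
  · rw [Finset.card_erase_of_mem hi]; omega
  · refine TP_cons S.alt (k + 1) (fun y => Pm α β ρ (m + 1) (J.erase i) y ∧ B (e m + f i) y = 0) _
      (fun y hy => hy.1) _ ?_ (fun y hy => hy.2) _
      (TP_cons S.alt k _ _ ?_ _ ?_ ?_ _ hw)
    · refine ⟨fun j hj => ?_, fun j => by rw [map_add, S.ρe, S.ρf, add_zero]⟩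
      have hj' : j ≠ m ∧ j ≠ i := by
        rcases hj with hj | hj
        · have h1 := Finset.mem_erase.1 hj
          have := Finset.mem_range.1 (hJ h1.2)
          exact ⟨by omega, h1.1⟩
        · omega
      rw [map_add, map_add, S.αe' j m hj'.1, S.αf, S.βe, S.βf' j i hj'.2]; simp
    · rintro y ⟨h1, h2⟩
      refine ⟨⟨fun j hj => h1 j ?_, h2⟩, ?_⟩
      · rcases hj with hj | hj
        · left; exact (Finset.mem_erase.1 hj).2
        · right; omega
      · rw [map_add, S.hβ, S.hα, LinearMap.add_apply, LinearMap.neg_apply,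
          (h1 m (Or.inr le_rfl)).2, (h1 i (Or.inl hi)).1]; simp
    · refine ⟨⟨fun j hj => ?_, fun j => by rw [map_add, S.ρe, S.ρf, add_zero]⟩, ?_⟩
      · have hj' : j ≠ m ∧ j ≠ i := by
          rcases hj with hj | hj
          · have h1 := Finset.mem_erase.1 hj
            have := Finset.mem_range.1 (hJ h1.2)
            exact ⟨by omega, h1.1⟩
          · omega
        rw [map_add, map_add, S.αe' j i hj'.2, S.αf, S.βe, S.βf' j m hj'.1]; simp
      · rw [map_add B, S.hβ, S.hα, LinearMap.add_apply, LinearMap.neg_apply, map_add, map_add,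
          S.βf m hm, S.βe, S.αf, S.αe i (by omega)]; simp
    · rintro y ⟨h1, h2⟩
      rw [map_add, S.hβ, S.hα, LinearMap.add_apply, LinearMap.neg_apply,
          (h1 m (Or.inr le_rfl)).1, (h1 i (Or.inl hi)).2]; simp
  · have ka := (hK.2.1 m le_rfl).1
    have kb := (hK.2.1 m le_rfl).2
    rw [pp_apply, ct_io_mul, ct_io_mul, ka, map_add (α m), map_add (α m), S.αe m hm, S.αf, S.αf,
      S.αe' m i (by omega), add_zero, add_zero, one_smul, zero_smul, mul_zero, sub_zero, mul_zero,
      sub_zero, ct_io_mul, kb, map_add (β m), S.βf m hm, S.βe]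
    simp

lemma KK_bot (m t q κ : ℕ) (h : κ < 2) : KK α β ρ m t q κ = ⊥ := by
  rw [eq_bot_iff]
  rintro x ⟨hx, -⟩
  interval_cases κ
  · exact hx
  · exact hx

lemma span_map_mem (T T' : Set (ExteriorAlgebra F V)) (u : V) (h : ∀ w ∈ T, io u * w ∈ T')
    (x : ExteriorAlgebra F V) (hx : x ∈ Submodule.span F T) :
    io u * x ∈ Submodule.span F T' := by
  refine Submodule.span_induction ?_ ?_ ?_ ?_ hx
  · intro w hw; exact Submodule.subset_span (h w hw)
  · simp
  · intro a b _ _ ha hb; rw [mul_add]; exact add_mem ha hb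
  · intro c a _ ha; rw [mul_smul_comm]; exact Submodule.smul_mem _ _ ha

lemma span_lift (S : Setup n d B e f r α β ρ) (m κ : ℕ) (hm : m < n) (hκ : κ ≤ m + 1)
    (x : ExteriorAlgebra F V) (hx : x ∈ Submodule.span F (TT B α β ρ m κ)) :
    ∃ y ∈ Submodule.span F (TT B α β ρ (m + 1) (κ + 2)), pp α β m y = x := by
  refine Submodule.span_induction ?_ ?_ ?_ ?_ hx
  · intro w hw
    obtain ⟨y, hy, h⟩ := TT_lift S m κ hm hκ w hw
    exact ⟨y, Submodule.subset_span hy, h⟩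
  · exact ⟨0, zero_mem _, map_zero _⟩
  · rintro _ _ _ _ ⟨a, ha, rfl⟩ ⟨b, hb, rfl⟩
    exact ⟨a + b, add_mem ha hb, map_add _ _ _⟩
  · rintro c _ _ ⟨a, ha, rfl⟩
    exact ⟨c • a, Submodule.smul_mem _ _ ha, map_smul _ _ _⟩

lemma span_TT_le (S : Setup n d B e f r α β ρ) (m κ : ℕ) (hm : m ≤ n) :
    Submodule.span F (TT B α β ρ m κ) ≤ KK α β ρ m 0 1 κ :=
  Submodule.span_le.2 fun w hw => TT_le S m κ hm w hw

lemma KK_le (S : Setup n d B e f r α β ρ) (m : ℕ) : m ≤ n → ∀ κ,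
    KK α β ρ m 0 1 κ ≤ Submodule.span F (TT B α β ρ m κ) := by
  induction m with
  | zero =>
    intro _ κ x hx
    rcases lt_trichotomy κ 2 with h | rfl | h
    · rw [KK_bot _ _ _ _ h] at hx
      rw [(Submodule.mem_bot F).1 hx]; exact zero_mem _
    · have hx' : x ∈ (1 : Submodule F (ExteriorAlgebra F V)) := by
        simpa [L] using hx.1
      obtain ⟨a, rfl⟩ := Submodule.mem_one.1 hx'
      rw [Algebra.algebraMap_eq_smul_one]
      refine Submodule.smul_mem _ _ (Submodule.subset_span ⟨0, ∅, rfl, by simp, by simp, ?_⟩)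
      refine ⟨fun i => 0, fun a => a.elim0, fun a => a.elim0, ?_⟩
      rw [ExteriorAlgebra.ιMulti_zero_apply]
    · rw [vanish S 0 (by omega) 1 κ x hx (by omega)]; exact zero_mem _
  | succ m ih =>
    intro hm κ x hx
    have ih' := ih (by omega)
    rcases lt_or_ge κ 2 with h | h
    · rw [KK_bot _ _ _ _ h] at hx
      rw [(Submodule.mem_bot F).1 hx]; exact zero_mem _
    rcases lt_or_ge (m + 3) κ with h' | h'
    · rw [vanish S (m + 1) (by omega) 1 κ x hx (by omega)]; exact zero_mem _
    obtain ⟨κ, rfl⟩ : ∃ k, κ = k + 2 := ⟨κ - 2, by omega⟩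
    obtain ⟨y, hy, hxy⟩ := span_lift S m κ (by omega) (by omega) _ (ih' _ (pp_mem m 0 κ x hx))
    have hz : x - y ∈ KK α β ρ (m + 1) 0 1 (κ + 2) := sub_mem hx (span_TT_le S _ _ hm hy)
    have hφ : ct (β m) (ct (α m) (x - y)) = 0 := by
      rw [← pp_apply, map_sub, hxy, sub_self]
    suffices hs : x - y ∈ Submodule.span F (TT B α β ρ (m + 1) (κ + 2)) by
      have := add_mem hs hy
      rwa [sub_add_cancel] at this
    generalize x - y = z at hz hφ
    have a1 := ct_α_mem m 0 (κ + 1) z hz hφ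
    have a2 := ct_β_mem m 0 (κ + 1) z hz hφ
    obtain ⟨b1, b2, b3⟩ := io_e_mem S m 0 _ (by omega) _ a1
    obtain ⟨c1, c2, c3⟩ := io_f_mem S m 0 _ (by omega) _ a2
    have hz0 : z - io (e m) * ct (α m) z - io (f m) * ct (β m) z ∈ KK α β ρ m 0 1 (κ + 2) := by
      refine KK_m_of m 0 _ _ (sub_mem (sub_mem hz b1) c1) ?_ ?_
      · rw [map_sub, map_sub, b2, c2]; simp
      · rw [map_sub, map_sub, b3, c3]; simp
    have d0 := Submodule.span_mono (TT_mono m (κ + 2)) (ih' _ hz0)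
    have d1 := span_map_mem _ _ _ (TT_e S m (κ + 1)) _ (ih' _ a1)
    have d2 := span_map_mem _ _ _ (TT_f S m (κ + 1)) _ (ih' _ a2)
    have := add_mem (add_mem d0 d2) d1
    rwa [sub_add_cancel, sub_add_cancel] at this



lemma finrank_split (K : Submodule F (ExteriorAlgebra F V)) [FiniteDimensional F K]
    (g : ExteriorAlgebra F V →ₗ[F] ExteriorAlgebra F V) :
    finrank F K = finrank F (K.map g) + finrank F (K ⊓ LinearMap.ker g : Submodule F _) := by
  have h := LinearMap.finrank_range_add_finrank_ker (g.domRestrict K)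
  rw [← h, LinearMap.range_domRestrict, LinearMap.ker_domRestrict]
  congr 1
  rw [(K.equivSubtypeMap _).finrank_eq, Submodule.map_comap_subtype]

instance KK_fin [FiniteDimensional F V] (m t q κ : ℕ) : FiniteDimensional F (KK α β ρ m t q κ) := by
  rcases lt_or_ge κ 2 with h | h
  · rw [KK_bot _ _ _ _ h]; infer_instance
  · obtain ⟨k, rfl⟩ : ∃ k, κ = k + 2 := ⟨κ - 2, by omega⟩
    have : FiniteDimensional F (L F V (k + 2)) :=
      inferInstanceAs (FiniteDimensional F (⋀[F]^k V))
    exact Submodule.finiteDimensional_of_le (fun x hx => hx.1 : KK α β ρ m t q (k + 2) ≤ L F V (k + 2))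

lemma finrank_t (S : Setup n d B e f r α β ρ) [FiniteDimensional F V] (m t κ : ℕ) (ht : t < d) :
    finrank F (KK α β ρ m (t + 1) 1 (κ + 1)) =
      finrank F (KK α β ρ m t 1 (κ + 1)) + finrank F (KK α β ρ m t 1 κ) := by
  rw [finrank_split _ (ct (ρ t))]
  have h1 : (KK α β ρ m (t + 1) 1 (κ + 1)).map (ct (ρ t)) = KK α β ρ m t 1 κ := by
    apply le_antisymm
    · rintro _ ⟨x, hx, rfl⟩
      exact ct_ρ_mem m t κ x hx
    · intro y hy
      obtain ⟨a, b⟩ := io_r_mem S m t κ ht y hy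
      exact ⟨_, a, b⟩
  have h2 : KK α β ρ m (t + 1) 1 (κ + 1) ⊓ LinearMap.ker (ct (ρ t)) = KK α β ρ m t 1 (κ + 1) := by
    apply le_antisymm
    · rintro x ⟨hx, h⟩
      exact KK_t_of m t _ x hx h
    · intro x hx
      exact ⟨KK_t_mono m t _ hx, hx.2.2.1 t le_rfl⟩
  rw [h1, h2, add_comm]

lemma finrank_m (S : Setup n d B e f r α β ρ) [FiniteDimensional F V] (m κ : ℕ) (hm : m < n)
    (hκ : κ ≤ m + 1) :
    finrank F (KK α β ρ (m + 1) 0 1 (κ + 2)) =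
      finrank F (KK α β ρ m 0 1 (κ + 2)) + 2 * finrank F (KK α β ρ m 0 1 (κ + 1)) +
        finrank F (KK α β ρ m 0 1 κ) := by
  rw [finrank_split _ (pp α β m)]
  have h1 : (KK α β ρ (m + 1) 0 1 (κ + 2)).map (pp α β m) = KK α β ρ m 0 1 κ := by
    apply le_antisymm
    · rintro _ ⟨x, hx, rfl⟩
      exact pp_mem m 0 κ x hx
    · intro y hy
      obtain ⟨x, hx, h⟩ := span_lift S m κ hm hκ y (KK_le S m hm.le κ hy)
      exact ⟨x, span_TT_le S _ _ hm hx, h⟩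
  have hf1 : FiniteDimensional F
      (KK α β ρ (m + 1) 0 1 (κ + 2) ⊓ LinearMap.ker (pp α β m) : Submodule F _) :=
    Submodule.finiteDimensional_of_le inf_le_left
  rw [h1, finrank_split (KK α β ρ (m + 1) 0 1 (κ + 2) ⊓ LinearMap.ker (pp α β m)) (ct (α m))]
  have h2 : (KK α β ρ (m + 1) 0 1 (κ + 2) ⊓ LinearMap.ker (pp α β m)).map (ct (α m)) =
      KK α β ρ m 0 1 (κ + 1) := by
    apply le_antisymm
    · rintro _ ⟨x, ⟨hx, h⟩, rfl⟩
      exact ct_α_mem m 0 _ x hx h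
    · intro y hy
      obtain ⟨a, b, c⟩ := io_e_mem S m 0 _ hm y hy
      refine ⟨_, ⟨a, ?_⟩, b⟩
      show pp α β m _ = 0
      rw [pp_apply, b, (hy.2.1 m le_rfl).2]
  have hf2 : FiniteDimensional F
      (KK α β ρ (m + 1) 0 1 (κ + 2) ⊓ LinearMap.ker (pp α β m) ⊓ LinearMap.ker (ct (α m)) :
        Submodule F _) :=
    Submodule.finiteDimensional_of_le (inf_le_left.trans inf_le_left)
  rw [h2, finrank_split (KK α β ρ (m + 1) 0 1 (κ + 2) ⊓ LinearMap.ker (pp α β m) ⊓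
    LinearMap.ker (ct (α m))) (ct (β m))]
  have h3 : (KK α β ρ (m + 1) 0 1 (κ + 2) ⊓ LinearMap.ker (pp α β m) ⊓
      LinearMap.ker (ct (α m))).map (ct (β m)) = KK α β ρ m 0 1 (κ + 1) := by
    apply le_antisymm
    · rintro _ ⟨x, ⟨⟨hx, h⟩, -⟩, rfl⟩
      exact ct_β_mem m 0 _ x hx h
    · intro y hy
      obtain ⟨a, b, c⟩ := io_f_mem S m 0 _ hm y hy
      refine ⟨_, ⟨⟨a, ?_⟩, b⟩, c⟩
      show pp α β m _ = 0
      rw [pp_apply, b, map_zero]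
  have h4 : KK α β ρ (m + 1) 0 1 (κ + 2) ⊓ LinearMap.ker (pp α β m) ⊓
      LinearMap.ker (ct (α m)) ⊓ LinearMap.ker (ct (β m)) = KK α β ρ m 0 1 (κ + 2) := by
    apply le_antisymm
    · rintro x ⟨⟨⟨hx, -⟩, ha⟩, hb⟩
      exact KK_m_of m 0 _ x hx ha hb
    · intro x hx
      have ha := (hx.2.1 m le_rfl).1
      refine ⟨⟨⟨KK_m_mono m 0 _ hx, ?_⟩, ha⟩, (hx.2.1 m le_rfl).2⟩
      show pp α β m _ = 0
      rw [pp_apply, ha, map_zero]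
  rw [h3, h4]
  ring

/-- the dimension numbers, shifted by `2` -/
def gg : ℕ → ℕ → ℤ
  | 0, κ => if κ = 2 then 1 else if κ = 4 then -1 else 0
  | (_ + 1), 0 => 0
  | (N + 1), (κ + 1) => gg N (κ + 1) + gg N κ

lemma gg_zero (N : ℕ) : gg N 0 = 0 := by
  cases N <;> simp [gg]

lemma gg_one (N : ℕ) : gg N 1 = 0 := by
  induction N with
  | zero => simp [gg]
  | succ N ih => rw [gg, ih, gg_zero]; rfl

lemma gg_eq (N k : ℕ) : gg N (k + 2) = (N.choose k : ℤ) - (if 2 ≤ k then N.choose (k - 2) else 0 : ℕ) := by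
  induction N generalizing k with
  | zero =>
    match k with
    | 0 => simp [gg]
    | 1 => simp [gg]
    | 2 => simp [gg]
    | (k + 3) => simp [gg]
  | succ N ih =>
    match k with
    | 0 => rw [gg, gg_one, ih]; simp
    | 1 => rw [gg, ih, ih]; simp
    | 2 =>
      rw [gg, ih, ih, Nat.choose_succ_succ N 1]
      simp; ring
    | (k + 3) =>
      rw [gg, ih, ih, Nat.choose_succ_succ N (k + 2), if_pos (by omega), if_pos (by omega),
        if_pos (by omega)]
      have : (N + 1).choose (k + 3 - 2) = N.choose k + N.choose (k + 1) := Nat.choose_succ_succ N k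
      rw [this]
      have h1 : k + 3 - 2 = k + 1 := by omega
      have h2 : k + 2 - 2 = k := by omega
      rw [h1, h2]
      push_cast
      ring

lemma gg_symm (m : ℕ) : gg (2 * m) (m + 3) = 0 := by
  have := gg_eq (2 * m) (m + 1)
  rw [show m + 3 = m + 1 + 2 from rfl, this]
  cases m with
  | zero => simp
  | succ m =>
    rw [if_pos (by omega), Nat.choose_symm_of_eq_add (show 2 * (m + 1) = (m + 1 + 1) + (m + 1 + 1 - 2) by omega)]
    simp

lemma gg_two (N κ : ℕ) : gg (N + 2) (κ + 2) = gg N (κ + 2) + 2 * gg N (κ + 1) + gg N κ := by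
  rw [gg, gg, gg]; ring

lemma dim_m (S : Setup n d B e f r α β ρ) [FiniteDimensional F V] (m : ℕ) : m ≤ n →
    ∀ κ, κ ≤ m + 3 → (finrank F (KK α β ρ m 0 1 κ) : ℤ) = gg (2 * m) κ := by
  induction m with
  | zero =>
    intro _ κ hκ
    rcases lt_trichotomy κ 2 with h | rfl | h
    · rw [KK_bot _ _ _ _ h, finrank_bot, gg, if_neg (by omega), if_neg (by omega)]; rfl
    · have : KK α β ρ 0 0 1 2 = Submodule.span F {(1 : ExteriorAlgebra F V)} := by
        apply le_antisymm
        · intro x hx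
          have hx' : x ∈ (1 : Submodule F (ExteriorAlgebra F V)) := by
            simpa [L] using hx.1
          rwa [Submodule.one_eq_span] at hx'
        · rw [Submodule.span_singleton_le_iff_mem]
          refine ⟨?_, fun i _ => ⟨ct_one _, ct_one _⟩, fun i _ => ct_one _, fun j hj => ?_⟩
          · show (1 : ExteriorAlgebra F V) ∈ LinearMap.range (io : V →ₗ[F] ExteriorAlgebra F V) ^ 0
            rw [pow_zero]; exact Submodule.one_le.1 le_rfl
          · obtain ⟨j, rfl⟩ : ∃ i, j = i + 1 := ⟨j - 1, by omega⟩
            rfl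
      rw [this, finrank_span_singleton one_ne_zero]
      simp [gg]
    · have : KK α β ρ 0 0 1 κ = ⊥ := by
        rw [eq_bot_iff]
        intro x hx
        exact vanish S 0 (by omega) 1 κ x hx (by omega)
      rw [this, finrank_bot, gg, if_neg (by omega), if_neg (by omega)]; rfl
  | succ m ih =>
    intro hm κ hκ
    have ih' := ih (by omega)
    rcases lt_or_ge κ 2 with h | h
    · rw [KK_bot _ _ _ _ h, finrank_bot]
      interval_cases κ
      · rw [gg_zero]; rfl
      · rw [gg_one]; rfl
    rcases eq_or_lt_of_le hκ with rfl | hκ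
    · have : KK α β ρ (m + 1) 0 1 (m + 1 + 3) = ⊥ := by
        rw [eq_bot_iff]
        intro x hx
        exact vanish S (m + 1) (by omega) 1 _ x hx (by omega)
      rw [this, finrank_bot, gg_symm]; rfl
    · obtain ⟨κ, rfl⟩ : ∃ k, κ = k + 2 := ⟨κ - 2, by omega⟩
      rw [finrank_m S m κ (by omega) (by omega), show 2 * (m + 1) = 2 * m + 2 by ring, gg_two,
        ← ih' _ (by omega), ← ih' _ (by omega), ← ih' _ (by omega)]
      push_cast; ring

lemma dim_t (S : Setup n d B e f r α β ρ) [FiniteDimensional F V] (t : ℕ) : t ≤ d →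
    ∀ κ, κ ≤ n + 3 → (finrank F (KK α β ρ n t 1 κ) : ℤ) = gg (2 * n + t) κ := by
  induction t with
  | zero => intro _ κ hκ; exact dim_m S n le_rfl κ hκ
  | succ t ih =>
    intro ht κ hκ
    cases κ with
    | zero => rw [KK_bot _ _ _ _ (by omega), finrank_bot, gg_zero]; rfl
    | succ κ =>
      rw [finrank_t S n t κ (by omega), show 2 * n + (t + 1) = (2 * n + t) + 1 by ring, gg]
      push_cast
      rw [ih (by omega) _ hκ, ih (by omega) _ (by omega)]

/-- all wedges of pairwise orthogonal tuples -/
def GT (B : V →ₗ[F] Dual F V) (κ : ℕ) : Set (ExteriorAlgebra F V) :=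
  {w | ∃ k, κ = k + 2 ∧ TP B k (fun _ => True) w}

lemma KK_GT (S : Setup n d B e f r α β ρ) (t : ℕ) : t ≤ d → ∀ κ,
    KK α β ρ n t 1 κ ≤ Submodule.span F (GT B κ) := by
  induction t with
  | zero =>
    intro _ κ
    refine (KK_le S n le_rfl κ).trans (Submodule.span_mono ?_)
    rintro w ⟨k, J, rfl, -, -, hw⟩
    exact ⟨k, rfl, TP_mono _ _ _ (fun _ _ => trivial) _ hw⟩
  | succ t ih =>
    intro ht κ x hx
    cases κ with
    | zero =>
      rw [KK_bot _ _ _ _ (by omega)] at hx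
      rw [(Submodule.mem_bot F).1 hx]; exact zero_mem _
    | succ κ =>
      have ih' := ih (by omega)
      have h1 := ct_ρ_mem n t κ x hx
      obtain ⟨h2, h3⟩ := io_r_mem S n t κ (by omega) _ h1
      have h4 := KK_t_of n t _ _ (sub_mem hx h2) (by rw [map_sub, h3, sub_self])
      have h5 := span_map_mem _ (GT B (κ + 1)) (r t) ?_ _ (ih' _ h1)
      · have := add_mem (ih' _ h4) h5
        rwa [sub_add_cancel] at this
      · rintro w ⟨k, rfl, hw⟩
        refine ⟨k + 1, rfl, TP_cons S.alt k _ _ (fun _ _ => trivial) _ trivial (fun y _ => ?_) _ hw⟩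
        rw [S.hr]; rfl

lemma GT_KK (S : Setup n d B e f r α β ρ) (κ : ℕ) :
    Submodule.span F (GT B κ) ≤ KK α β ρ n d 1 κ := by
  refine Submodule.span_le.2 ?_
  rintro w ⟨k, rfl, v, -, h2, rfl⟩
  refine ⟨wedge_mem k v, fun i hi => ?_, fun i hi => ?_, fun j hj => ?_⟩
  · rw [S.αz i hi, S.βz i hi, ct_zero]; simp
  · rw [S.ρz i hi, ct_zero]
  obtain ⟨j, rfl⟩ : ∃ i, j = i + 1 := ⟨j - 1, by omega⟩
  refine DD_wedge α β n k v (fun a b => ?_) j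
  rw [CC_n S]
  exact h2 a b

lemma dim_GT (S : Setup n d B e f r α β ρ) [FiniteDimensional F V] (k : ℕ) (hk : k ≤ n) :
    finrank F (Submodule.span F (GT B (k + 2))) =
      (2 * n + d).choose k - (if 2 ≤ k then (2 * n + d).choose (k - 2) else 0) := by
  have h : Submodule.span F (GT B (k + 2)) = KK α β ρ n d 1 (k + 2) :=
    le_antisymm (GT_KK S _) (KK_GT S d le_rfl _)
  have h2 := dim_t S d le_rfl (k + 2) (by omega)
  rw [gg_eq] at h2
  rw [h]
  omega

end Main

section Extract

variable {F : Type*} [Field F] {V : Type*} [AddCommGroup V] [Module F V] [FiniteDimensional F V]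

lemma exists_setup (B : V →ₗ[F] Dual F V) (halt : ∀ x, B x x = 0) (n d : ℕ)
    (W : Fin n → Submodule F V) (R : Submodule F V)
    (hsup : ∀ p : Submodule F V, (∀ i, W i ≤ p) → R ≤ p → p = ⊤)
    (horth : ∀ i j, i ≠ j → ∀ x ∈ W i, ∀ y ∈ W j, B x y = 0)
    (hW : ∀ i, ∃ e f : V, W i = Submodule.span F {e, f} ∧ B e f = 1)
    (hR : ∀ v, v ∈ R ↔ B v = 0) (hd : finrank F R = d) :
    ∃ (e f r : ℕ → V) (α β ρ : ℕ → Dual F V), Setup n d B e f r α β ρ := by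
  choose e0 f0 hW0 hef0 using hW
  have he0 : ∀ i, e0 i ∈ W i := fun i => by
    rw [hW0]; exact Submodule.subset_span (by simp)
  have hf0 : ∀ i, f0 i ∈ W i := fun i => by
    rw [hW0]; exact Submodule.subset_span (by simp)
  have hsk : ∀ x y, B x y = - B y x := by
    intro x y
    have := halt (x + y)
    simp only [map_add, LinearMap.add_apply, halt] at this
    rw [zero_add, add_zero] at this
    exact eq_neg_of_add_eq_zero_right this
  let e : ℕ → V := fun i => if h : i < n then e0 ⟨i, h⟩ else 0
  let f : ℕ → V := fun i => if h : i < n then f0 ⟨i, h⟩ else 0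
  have hez : ∀ i, n ≤ i → e i = 0 := fun i h => dif_neg (by omega)
  have hfz : ∀ i, n ≤ i → f i = 0 := fun i h => dif_neg (by omega)
  have hes : ∀ i (h : i < n), e i = e0 ⟨i, h⟩ := fun i h => dif_pos h
  have hfs : ∀ i (h : i < n), f i = f0 ⟨i, h⟩ := fun i h => dif_pos h
  have hef : ∀ i, i < n → B (e i) (f i) = 1 := fun i h => by rw [hes i h, hfs i h, hef0]
  have hef' : ∀ i j, i ≠ j → B (e i) (f j) = 0 := by
    intro i j hij
    by_cases hi : i < n
    · by_cases hj : j < n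
      · rw [hes i hi, hfs j hj]
        exact horth _ _ (by simpa using hij) _ (he0 _) _ (hf0 _)
      · rw [hfz j (by omega), map_zero]
    · rw [hez i (by omega), map_zero]; rfl
  have hee : ∀ i j, B (e i) (e j) = 0 := by
    intro i j
    by_cases hij : i = j
    · rw [hij, halt]
    by_cases hi : i < n
    · by_cases hj : j < n
      · rw [hes i hi, hes j hj]
        exact horth _ _ (by simpa using hij) _ (he0 _) _ (he0 _)
      · rw [hez j (by omega), map_zero]
    · rw [hez i (by omega), map_zero]; rfl
  have hff : ∀ i j, B (f i) (f j) = 0 := by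
    intro i j
    by_cases hij : i = j
    · rw [hij, halt]
    by_cases hi : i < n
    · by_cases hj : j < n
      · rw [hfs i hi, hfs j hj]
        exact horth _ _ (by simpa using hij) _ (hf0 _) _ (hf0 _)
      · rw [hfz j (by omega), map_zero]
    · rw [hfz i (by omega), map_zero]; rfl
  let α : ℕ → Dual F V := fun i => - B (f i)
  let β : ℕ → Dual F V := fun i => B (e i)
  have hα : ∀ i v, α i v = B v (f i) := fun i v => by rw [hsk]; rfl
  have hαe : ∀ i, i < n → α i (e i) = 1 := fun i h => by rw [hα, hef i h]
  have hαe' : ∀ i j, i ≠ j → α i (e j) = 0 := fun i j h => by rw [hα, hef' j i h.symm]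
  have hαf : ∀ i j, α i (f j) = 0 := fun i j => by rw [hα, hff]
  have hRr : ∀ v ∈ R, ∀ w, B w v = 0 := fun v hv w => by
    rw [hsk, (hR v).1 hv]; simp
  have hαR : ∀ i, ∀ v ∈ R, α i v = 0 := fun i v hv => by rw [hα, (hR v).1 hv]; rfl
  have hβR : ∀ i, ∀ v ∈ R, β i v = 0 := fun i v hv => hRr v hv _
  let Q : V →ₗ[F] V :=
    ∑ i ∈ Finset.range n, ((α i).smulRight (e i) + (β i).smulRight (f i))
  have hQ : ∀ v, Q v = ∑ i ∈ Finset.range n, (α i v • e i + β i v • f i) := by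
    intro v; simp [Q, LinearMap.sum_apply]
  have hαQ : ∀ j v, α j (Q v) = α j v := by
    intro j v
    rw [hQ, map_sum]
    simp only [map_add, map_smul, hαf, add_zero, smul_eq_mul, mul_zero]
    by_cases hj : j < n
    · rw [Finset.sum_eq_single j, hαe j hj, mul_one]
      · intro i _ hi; rw [hαe' j i hi.symm, mul_zero]
      · intro h; exact absurd (Finset.mem_range.2 hj) h
    · have : α j = 0 := by simp [α, hfz j (by omega)]
      simp [this]
  have hβQ : ∀ j v, β j (Q v) = β j v := by
    intro j v
    rw [hQ, map_sum]
    have h0 : ∀ i, β j (e i) = 0 := fun i => hee j i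
    simp only [map_add, map_smul, h0, smul_zero, zero_add, smul_eq_mul, mul_zero]
    by_cases hj : j < n
    · rw [Finset.sum_eq_single j]
      · rw [show β j (f j) = 1 from hef j hj, mul_one]
      · intro i _ hi; rw [show β j (f i) = 0 from hef' j i hi.symm, mul_zero]
      · intro h; exact absurd (Finset.mem_range.2 hj) h
    · have : β j = 0 := by simp [β, hez j (by omega)]
      simp [this]
  have hPR : ∀ v, v - Q v ∈ R := by
    intro v
    rw [hR]
    have : LinearMap.ker (B (v - Q v)) = ⊤ := by
      refine hsup _ (fun i => ?_) (fun y hy => hRr y hy _)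
      rw [hW0, Submodule.span_le]
      rintro y hy
      rw [SetLike.mem_coe, LinearMap.mem_ker]
      rcases hy with rfl | rfl
      · rw [← hes i.1 i.2, hsk]
        show - β i.1 (v - Q v) = 0
        rw [map_sub, hβQ, sub_self, neg_zero]
      · rw [← hfs i.1 i.2, ← hα, map_sub, hαQ, sub_self]
    exact LinearMap.ker_eq_top.1 this
  let P : V →ₗ[F] R := LinearMap.codRestrict R (LinearMap.id - Q) hPR
  have hP : ∀ v, (P v : V) = v - Q v := fun v => rfl
  let b : Basis (Fin d) F R := finBasisOfFinrankEq F R hd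
  let r : ℕ → V := fun j => if h : j < d then (b ⟨j, h⟩ : V) else 0
  let ρ : ℕ → Dual F V := fun j => if h : j < d then b.coord ⟨j, h⟩ ∘ₗ P else 0
  have hrR : ∀ j, r j ∈ R := by
    intro j
    by_cases h : j < d
    · simp [r, h]
    · simp [r, h]
  have hρP : ∀ j v, P v = 0 → ρ j v = 0 := by
    intro j v hv
    by_cases h : j < d
    · simp [ρ, h, hv]
    · simp [ρ, h]
  have hQe : ∀ j, P (e j) = 0 := by
    intro j
    apply Subtype.ext
    rw [hP, hQ]
    have h0 : ∀ i, β i (e j) = 0 := fun i => hee i j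
    simp only [h0, zero_smul, add_zero]
    by_cases hj : j < n
    · rw [Finset.sum_eq_single j, hαe j hj, one_smul, sub_self]
      · rfl
      · intro i _ hi; rw [hαe' i j hi, zero_smul]
      · intro h; exact absurd (Finset.mem_range.2 hj) h
    · simp [hez j (by omega)]
  have hQf : ∀ j, P (f j) = 0 := by
    intro j
    apply Subtype.ext
    rw [hP, hQ]
    simp only [hαf, zero_smul, zero_add]
    by_cases hj : j < n
    · rw [Finset.sum_eq_single j, show β j (f j) = 1 from hef j hj, one_smul, sub_self]
      · rfl
      · intro i _ hi; rw [show β i (f j) = 0 from hef' i j hi, zero_smul]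
      · intro h; exact absurd (Finset.mem_range.2 hj) h
    · simp [hfz j (by omega)]
  have hPr : ∀ j (h : j < d), P (r j) = b ⟨j, h⟩ := by
    intro j h
    apply Subtype.ext
    rw [hP, hQ, Finset.sum_eq_zero]
    · simp [r, h]
    · intro i _; rw [hαR i _ (hrR j), hβR i _ (hrR j)]; simp
  refine ⟨e, f, r, α, β, ρ, ⟨halt, fun i => (neg_neg _).symm, fun i => rfl,
    fun i => (hR _).1 (hrR i), hαe, hαe', hαf, hef, hef', hee, fun i j => hαR i _ (hrR j),
    fun i j => hβR i _ (hrR j), fun i j => hρP _ _ (hQe j), fun i j => hρP _ _ (hQf j),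
    ?_, ?_, ?_, ?_, ?_, ?_⟩⟩
  · intro i hi
    simp [ρ, hi, hPr i hi]
  · intro i j hij
    by_cases hi : i < d
    · by_cases hj : j < d
      · simp only [ρ, hi, dif_pos, LinearMap.comp_apply, hPr j hj, Basis.coord_apply,
          Basis.repr_self]
        rw [Finsupp.single_apply, if_neg]
        simpa using hij.symm
      · have : r j = 0 := dif_neg hj
        rw [this, map_zero]
    · have : ρ i = 0 := dif_neg hi
      rw [this]; rfl
  · intro i hi; simp [α, hfz i hi]
  · intro i hi; simp [β, hez i hi]
  · intro i hi; exact dif_neg (by omega)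
  · intro v
    rw [← hQ, Finset.sum_range]
    have h1 : ∀ j : Fin d, ρ j v • r j = ((b.repr (P v) j • b j : R) : V) := by
      intro j
      simp [ρ, r]
    rw [Finset.sum_congr rfl fun j _ => h1 j, ← Submodule.coe_sum, b.sum_repr, hP]
    abel

end Extract

end SympGrass

open PolarGrass Module in
/-- a possibly degenerate alternating bilinear form of reduced Witt index
`n ≥ 2` and singular defect `d` (`N = 2n + d`); for `1 ≤ k ≤ n` the Grassmann image has
dimension `N.choose k - N.choose (k-2)`, with `N.choose (-1) = 0`. -/
theorem stmt1 (F : Type*) [Field F] (V : Type*) [AddCommGroup V] [Module F V]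
    [FiniteDimensional F V]
    (s : V → V → F) (halt : IsAlternatingForm F V s)
    (n d N : ℕ) (hn : 2 ≤ n)
    (hdec : HasWittDecomp F V s (fun v => s v v = 0) (radSetB F V s) n 0 d)
    (hNV : Module.finrank F V = N) (hN : N = 2 * n + d) :
    ∀ k : ℕ, 1 ≤ k → k ≤ n →
      Module.finrank F ↥(grassmann F V (TotSingB F V s) k)
        = N.choose k - (if 2 ≤ k then N.choose (k - 2) else 0) := by
  obtain ⟨W, W₀, R, hInternal, horth, hW, -, hW0, hR, hd⟩ := hdec
  obtain ⟨a1, a2, a3, a4, a5⟩ := halt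
  let B : V →ₗ[F] Dual F V := LinearMap.mk₂ F s a1 a3 a2 a4
  have hB : ∀ x y, B x y = s x y := fun x y => rfl
  have hW0' : W₀ = ⊥ := Submodule.finrank_eq_zero.1 hW0
  have key : ∃ (e f r : ℕ → V) (α β ρ : ℕ → Dual F V), SympGrass.Setup n d B e f r α β ρ := by
    refine SympGrass.exists_setup B a5 n d W R ?_ ?_ ?_ ?_ hd
    · intro p hp hRp
      rw [eq_top_iff, ← hInternal.submodule_iSup_eq_top]
      refine iSup_le fun j => ?_
      rcases j with j | j
      · exact hp j
      · fin_cases j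
        · simp [hW0']
        · exact hRp
    · intro i j hij x hx y hy
      exact horth (Sum.inl i) (Sum.inl j) (by simpa using hij) x hx y hy
    · intro i
      obtain ⟨e, f, h1, -, -, h2⟩ := hW i
      exact ⟨e, f, h1, h2⟩
    · intro v
      rw [← SetLike.mem_coe, hR]
      constructor
      · intro h
        ext w
        exact h w
      · intro h w
        rw [← hB, h]
        rfl
  obtain ⟨e, f, r, α, β, ρ, S⟩ := key
  intro k _ hk
  rw [hN, ← SympGrass.dim_GT S k hk]
  have : grassmann F V (TotSingB F V s) k = Submodule.span F (SympGrass.GT B (k + 2)) := by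
    apply le_antisymm
    · refine Submodule.span_mono ?_
      rintro x ⟨v, -, -, hv, rfl⟩
      refine ⟨k, rfl, v, fun _ => trivial, fun a b => ?_, rfl⟩
      exact hv _ (Submodule.subset_span ⟨a, rfl⟩) _ (Submodule.subset_span ⟨b, rfl⟩)
    · refine Submodule.span_le.2 ?_
      rintro x ⟨k', hk', v, -, hv, rfl⟩
      obtain rfl : k = k' := by omega
      by_cases hli : LinearIndependent F v
      · refine Submodule.subset_span ⟨v, fun _ => trivial, hli, ?_, rfl⟩
        have h1 : ∀ a, ∀ y ∈ Submodule.span F (Set.range v), B (v a) y = 0 := by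
          intro a y hy
          have : Submodule.span F (Set.range v) ≤ LinearMap.ker (B (v a)) := by
            rw [Submodule.span_le]
            rintro _ ⟨b, rfl⟩
            exact hv a b
          exact this hy
        intro x hx y hy
        have : Submodule.span F (Set.range v) ≤ LinearMap.ker (B.flip y) := by
          rw [Submodule.span_le]
          rintro _ ⟨a, rfl⟩
          exact h1 a y hy
        exact this hx
      · rw [AlternatingMap.map_linearDependent _ v hli]
        exact zero_mem _
  rw [this]
end
end

section
/- Suppose char(F) ≠ 2 and let q have reduced Witt index n ≥ 2, anisotropic defect d₀ and singular defect d (so N = 2n + d₀ + d); q may be degenerate. Then for every integer k with 1 ≤ k ≤ n, the Grassmann image G_k(q) equals all of ⋀^k V; in particular dim G_k(q) = binom(N, k). -/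
noncomputable section

namespace PolarGrass

open Module

section Aux

variable {F : Type*} [Field F] {V : Type*} [AddCommGroup V] [Module F V]

/-- The wedge product of a list of vectors. -/
def wedge (l : List V) : ExteriorAlgebra F V := (l.map (ExteriorAlgebra.ι F)).prod

/-- A list of mutually orthogonal isotropic vectors. -/
def TSList (B : LinearMap.BilinForm F V) (l : List V) : Prop :=
  ∀ x ∈ l, ∀ y ∈ l, B x y = 0

/-- Span of wedges of totally isotropic lists of length `K`. -/
def GG (B : LinearMap.BilinForm F V) (K : ℕ) : Submodule F (ExteriorAlgebra F V) :=
  Submodule.span F {x | ∃ l : List V, l.length = K ∧ TSList B l ∧ x = wedge l}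

theorem wedge_append (l l' : List V) : wedge (F := F) (l ++ l') = wedge l * wedge l' := by
  simp [wedge]

theorem wedge_cons (x : V) (l : List V) :
    wedge (F := F) (x :: l) = ExteriorAlgebra.ι F x * wedge l := by
  simp [wedge]

theorem wedge_perm {l l' : List V} (h : l.Perm l') :
    wedge (F := F) l = wedge l' ∨ wedge (F := F) l = - wedge l' := by
  induction h with
  | nil => left; rfl
  | cons x _ ih =>
    rcases ih with ih | ih
    · left; rw [wedge_cons, wedge_cons, ih]
    · right; rw [wedge_cons, wedge_cons, ih, mul_neg]
  | swap x y l =>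
    right
    have := ExteriorAlgebra.ι_add_mul_swap (R := F) x y
    rw [wedge_cons, wedge_cons, wedge_cons, wedge_cons, ← mul_assoc, ← mul_assoc,
      eq_neg_of_add_eq_zero_right this, neg_mul]
  | trans _ _ ih1 ih2 =>
    rcases ih1 with h1 | h1 <;> rcases ih2 with h2 | h2 <;> simp [h1, h2]

/-- A family of mutually orthogonal hyperbolic pairs and additional orthogonal vectors. -/
structure HypData {n : ℕ} {J : Type*} (B : LinearMap.BilinForm F V)
    (h : Fin n → Bool → V) (w : J → V) : Prop where
  symm : ∀ x y, B x y = B y x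
  hh : ∀ i s, B (h i s) (h i s) = 0
  hp : ∀ i s, B (h i s) (h i (!s)) = 1
  ho : ∀ i i', i ≠ i' → ∀ s t, B (h i s) (h i' t) = 0
  wo : ∀ j j', j ≠ j' → B (w j) (w j') = 0
  wh : ∀ j i s, B (w j) (h i s) = 0

variable {n : ℕ} {J : Type*}

/-- The combined family. -/
def fam (h : Fin n → Bool → V) (w : J → V) : (Fin n × Bool) ⊕ J → V :=
  Sum.elim (fun a => h a.1 a.2) w

/-- The invariant of the induction. -/
structure Inv (B : LinearMap.BilinForm F V) (h : Fin n → Bool → V) (w : J → V)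
    (p : List V) (I : Finset (Fin n)) (c : List ((Fin n × Bool) ⊕ J)) : Prop where
  ts : TSList B p
  ph : ∀ x ∈ p, ∀ i ∈ I, ∀ s, B x (h i s) = 0
  pw : ∀ x ∈ p, ∀ j, Sum.inr j ∈ c → B x (w j) = 0

theorem Inv.snoc {B : LinearMap.BilinForm F V} {h : Fin n → Bool → V} {w : J → V}
    (symm : ∀ x y, B x y = B y x)
    {p : List V} {I I' : Finset (Fin n)} {c c' : List ((Fin n × Bool) ⊕ J)}
    (H : Inv B h w p I c) (hI : I' ⊆ I) (hc : c' ⊆ c) (x : V) (hx : B x x = 0)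
    (hpx : ∀ y ∈ p, B y x = 0) (hxh : ∀ i ∈ I', ∀ s, B x (h i s) = 0)
    (hxw : ∀ j, Sum.inr j ∈ c' → B x (w j) = 0) :
    Inv B h w (p ++ [x]) I' c' := by
  refine ⟨?_, ?_, ?_⟩
  · intro a ha b hb
    simp only [List.mem_append, List.mem_singleton] at ha hb
    rcases ha with ha | rfl <;> rcases hb with hb | rfl
    · exact H.ts a ha b hb
    · exact hpx a ha
    · rw [symm]; exact hpx b hb
    · exact hx
  · intro a ha i hi s
    simp only [List.mem_append, List.mem_singleton] at ha
    rcases ha with ha | rfl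
    · exact H.ph a ha i (hI hi) s
    · exact hxh i hi s
  · intro a ha j hj
    simp only [List.mem_append, List.mem_singleton] at ha
    rcases ha with ha | rfl
    · exact H.pw a ha j (hc hj)
    · exact hxw j hj

/-- The first components of the hyperbolic indices in a list. -/
def touched (c : List ((Fin n × Bool) ⊕ J)) : List (Fin n) :=
  c.filterMap (fun a => Sum.elim (fun b => some b.1) (fun _ => none) a)

theorem mem_touched (c : List ((Fin n × Bool) ⊕ J)) (i : Fin n) (s : Bool)
    (hi : Sum.inl (i, s) ∈ c) : i ∈ touched c := by
  unfold touched
  rw [List.mem_filterMap]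
  exact ⟨_, hi, rfl⟩

theorem exists_untouched (c : List ((Fin n × Bool) ⊕ J)) (I : Finset (Fin n))
    (h : c.length < I.card) : ∃ i ∈ I, ∀ s, Sum.inl (i, s) ∉ c := by
  classical
  have h1 : (touched c).toFinset.card < I.card :=
    lt_of_le_of_lt ((List.toFinset_card_le _).trans (List.length_filterMap_le _ _)) h
  obtain ⟨i, hi, hn⟩ := Finset.exists_mem_notMem_of_card_lt_card h1
  exact ⟨i, hi, fun s hs => hn (by simpa using mem_touched c i s hs)⟩

set_option maxHeartbeats 2000000 in
theorem main_step {B : LinearMap.BilinForm F V} {h : Fin n → Bool → V} {w : J → V}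
    (two : (2 : F) ≠ 0) (D : HypData B h w) (m : ℕ) :
    ∀ (c : List ((Fin n × Bool) ⊕ J)) (I : Finset (Fin n)) (p : List V),
      c.length = m → c.Nodup → m ≤ I.card → (∀ i s, Sum.inl (i, s) ∈ c → i ∈ I) →
      Inv B h w p I c →
      wedge p * wedge (c.map (fam h w)) ∈ GG B (p.length + m) := by
  classical
  induction m using Nat.strong_induction_on with
  | _ m ih =>
  intro c I p hcm hnd hmI hcI H
  cases c with
  | nil =>
    simp only [List.length_nil] at hcm
    subst hcm
    refine Submodule.subset_span ⟨p, rfl, H.ts, by simp [wedge]⟩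
  | cons a c =>
  simp only [List.length_cons] at hcm
  have hac : a ∉ c := (List.nodup_cons.1 hnd).1
  have hndc : c.Nodup := (List.nodup_cons.1 hnd).2
  have hsub : c ⊆ a :: c := List.subset_cons_self a c
  -- one step with a single vector
  have one : ∀ (i : Fin n), i ∈ I → (∀ s, Sum.inl (i, s) ∉ c) → ∀ x : V, B x x = 0 →
      (∀ y ∈ p, B y x = 0) → (∀ i' ∈ I.erase i, ∀ s, B x (h i' s) = 0) →
      (∀ j, Sum.inr j ∈ c → B x (w j) = 0) →
      wedge p * (ExteriorAlgebra.ι F x * wedge (c.map (fam h w))) ∈ GG B (p.length + m) := by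
    intro i hi hic x hxx hpx hxh hxw
    have := ih c.length (by omega) c (I.erase i) (p ++ [x]) rfl hndc
      (by rw [Finset.card_erase_of_mem hi]; omega)
      (fun i' s hs => Finset.mem_erase.2 ⟨by rintro rfl; exact hic s hs,
        hcI i' s (hsub hs)⟩)
      (H.snoc D.symm (Finset.erase_subset _ _) hsub x hxx hpx hxh hxw)
    rw [wedge_append, mul_assoc] at this
    have e : (p ++ [x]).length + c.length = p.length + m := by simp; omega
    rw [e] at this
    simpa [wedge] using this
  rw [List.map_cons, wedge_cons]
  rcases a with ⟨i, s⟩ | j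
  · have hiI : i ∈ I := hcI i s (by simp)
    by_cases hop : Sum.inl (i, !s) ∈ c
    · -- a hyperbolic pair
      obtain ⟨c', hperm⟩ : ∃ c', c.Perm (Sum.inl (i, !s) :: c') := by
        obtain ⟨l₁, l₂, rfl⟩ := List.append_of_mem hop
        exact ⟨l₁ ++ l₂, List.perm_middle⟩
      have hlen : c.length = c'.length + 1 := by simpa using hperm.length_eq
      have hnd' := (hperm.nodup_iff).1 hndc
      have hop' : Sum.inl (i, !s) ∉ c' := (List.nodup_cons.1 hnd').1
      have hndc' : c'.Nodup := (List.nodup_cons.1 hnd').2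
      have hc'c : c' ⊆ c := fun y hy => hperm.mem_iff.2 (List.mem_cons_of_mem _ hy)
      have hic' : ∀ t, Sum.inl (i, t) ∉ c' := by
        intro t ht
        by_cases hts : t = s
        · subst hts; exact hac (hc'c ht)
        · have : t = !s := by cases t <;> cases s <;> simp_all
          subst this; exact hop' ht
      obtain ⟨i', hi', hi'c⟩ := exists_untouched c' (I.erase i)
        (by rw [Finset.card_erase_of_mem hiI]; omega)
      obtain ⟨hne, hi'I⟩ := Finset.mem_erase.1 hi'
      have pair : ∀ x y : V, B x x = 0 → B y y = 0 → B x y = 0 →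
          (∀ z ∈ p, B z x = 0) → (∀ z ∈ p, B z y = 0) →
          (∀ k ∈ (I.erase i).erase i', ∀ s, B x (h k s) = 0) →
          (∀ k ∈ (I.erase i).erase i', ∀ s, B y (h k s) = 0) →
          (∀ j, B x (w j) = 0) → (∀ j, B y (w j) = 0) →
          wedge p * (ExteriorAlgebra.ι F x * ExteriorAlgebra.ι F y) *
            wedge (c'.map (fam h w)) ∈ GG B (p.length + m) := by
        intro x y hxx hyy hxy hpx hpy hxh hyh hxw hyw
        have := ih c'.length (by omega) c' ((I.erase i).erase i') (p ++ [x] ++ [y]) rfl hndc'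
          (by rw [Finset.card_erase_of_mem hi', Finset.card_erase_of_mem hiI]; omega)
          (fun k t hs => Finset.mem_erase.2 ⟨by rintro rfl; exact hi'c t hs,
            Finset.mem_erase.2 ⟨by rintro rfl; exact hic' t hs,
              hcI k t (hsub (hc'c hs))⟩⟩)
          ((H.snoc D.symm (I' := (I.erase i).erase i')
            ((Finset.erase_subset _ _).trans (Finset.erase_subset _ _))
            (c' := c') (fun z hz => hsub (hc'c hz)) x hxx hpx hxh (fun j _ => hxw j)).snoc
            D.symm (Finset.Subset.refl _) (List.Subset.refl _) y hyy
            (by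
              intro z hz
              simp only [List.mem_append, List.mem_singleton] at hz
              rcases hz with hz | rfl
              · exact hpy z hz
              · exact hxy) hyh (fun j _ => hyw j))
        have e : (p ++ [x] ++ [y]).length + c'.length = p.length + m := by simp; omega
        rw [e] at this
        simpa [wedge, mul_assoc] using this
      -- the basic facts
      have hw : ∀ k t j, B (h k t) (w j) = 0 := fun k t j => by rw [D.symm, D.wh]
      have hk1 : ∀ k ∈ (I.erase i).erase i', ∀ s t, B (h i t) (h k s) = 0 := by
        intro k hk s t
        simp only [Finset.mem_erase] at hk
        exact D.ho _ _ (Ne.symm hk.2.1) _ _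
      have hk2 : ∀ k ∈ (I.erase i).erase i', ∀ s t, B (h i' t) (h k s) = 0 := by
        intro k hk s t
        simp only [Finset.mem_erase] at hk
        exact D.ho _ _ (Ne.symm hk.1) _ _
      have o1 : ∀ s t, B (h i s) (h i' t) = 0 := D.ho _ _ (Ne.symm hne)
      have o2 : ∀ s t, B (h i' s) (h i t) = 0 := D.ho _ _ hne
      have q1 := D.hp i s
      have q2 : B (h i (!s)) (h i s) = 1 := by rw [D.symm, q1]
      have q3 : B (h i' true) (h i' false) = 1 := D.hp i' true
      have q4 : B (h i' false) (h i' true) = 1 := D.hp i' false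
      have p1 : ∀ z ∈ p, ∀ t, B z (h i t) = 0 := fun z hz t => H.ph z hz i hiI t
      have p2 : ∀ z ∈ p, ∀ t, B z (h i' t) = 0 := fun z hz t => H.ph z hz i' hi'I t
      have hh := D.hh
      have T1 := pair (h i s + h i' true) (h i (!s) - h i' false)
        (by simp [*]) (by simp [*]) (by simp [*])
        (by intro z hz; simp [p1 z hz, p2 z hz]) (by intro z hz; simp [p1 z hz, p2 z hz])
        (by intro k hk t; simp [hk1 k hk, hk2 k hk]) (by intro k hk t; simp [hk1 k hk, hk2 k hk])
        (by simp [hw]) (by simp [hw])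
      have T2 := pair (h i s + h i' false) (h i (!s) - h i' true)
        (by simp [*]) (by simp [*]) (by simp [*])
        (by intro z hz; simp [p1 z hz, p2 z hz]) (by intro z hz; simp [p1 z hz, p2 z hz])
        (by intro k hk t; simp [hk1 k hk, hk2 k hk]) (by intro k hk t; simp [hk1 k hk, hk2 k hk])
        (by simp [hw]) (by simp [hw])
      have T3 : ∀ s t, wedge p * (ExteriorAlgebra.ι F (h i s) * ExteriorAlgebra.ι F (h i' t)) *
            wedge (c'.map (fam h w)) ∈ GG B (p.length + m) := fun s t =>
        pair (h i s) (h i' t) (hh _ _) (hh _ _) (o1 _ _) (fun z hz => p1 z hz _)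
          (fun z hz => p2 z hz _) (fun k hk u => hk1 k hk u _) (fun k hk u => hk2 k hk u _)
          (hw _ _) (hw _ _)
      have T4 : ∀ s t, wedge p * (ExteriorAlgebra.ι F (h i' s) * ExteriorAlgebra.ι F (h i t)) *
            wedge (c'.map (fam h w)) ∈ GG B (p.length + m) := fun s t =>
        pair (h i' s) (h i t) (hh _ _) (hh _ _) (o2 _ _) (fun z hz => p2 z hz _)
          (fun z hz => p1 z hz _) (fun k hk u => hk2 k hk u _) (fun k hk u => hk1 k hk u _)
          (hw _ _) (hw _ _)
      have sw : ExteriorAlgebra.ι F (h i' false) * ExteriorAlgebra.ι F (h i' true)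
          = -(ExteriorAlgebra.ι F (h i' true) * ExteriorAlgebra.ι F (h i' false)) :=
        eq_neg_of_add_eq_zero_left (ExteriorAlgebra.ι_add_mul_swap _ _)
      have key : wedge p * (ExteriorAlgebra.ι F (h i s) * ExteriorAlgebra.ι F (h i (!s))) *
            wedge (c'.map (fam h w)) ∈ GG B (p.length + m) := by
        rw [← Submodule.smul_mem_iff _ two]
        have S := (GG B (p.length + m)).sub_mem ((GG B (p.length + m)).add_mem
          ((GG B (p.length + m)).sub_mem ((GG B (p.length + m)).add_mem
            ((GG B (p.length + m)).add_mem T1 T2) (T3 s false)) (T4 true (!s)))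
            (T3 s true)) (T4 false (!s))
        convert S using 1
        rw [two_smul]
        simp only [map_add, map_sub, add_mul, mul_add, sub_mul, mul_sub, sw, mul_neg, neg_mul]
        abel
      have fin1 : wedge p * (ExteriorAlgebra.ι F (h i s) *
          wedge ((Sum.inl (i, !s) :: c').map (fam h w))) ∈ GG B (p.length + m) := by
        rw [List.map_cons, wedge_cons]
        simpa [fam, mul_assoc] using key
      rcases wedge_perm (F := F) (hperm.map (fam h w)) with e | e
      · rw [e]; exact fin1
      · rw [e, mul_neg, mul_neg]; exact Submodule.neg_mem _ fin1
    · refine one i hiI ?_ (h i s) (D.hh _ _) (fun y hy => H.ph y hy i hiI s) ?_ ?_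
      · intro t ht
        by_cases hts : t = s
        · subst hts; exact hac ht
        · have : t = !s := by cases t <;> cases s <;> simp_all
          subst this; exact hop ht
      · intro i' hi' t
        exact D.ho _ _ (Ne.symm (Finset.mem_erase.1 hi').1) _ _
      · intro j _
        rw [D.symm, D.wh]
  · obtain ⟨i, hi, hic⟩ := exists_untouched c I (by omega)
    have hw : ∀ k t j, B (h k t) (w j) = 0 := fun k t j => by rw [D.symm, D.wh]
    have hpw : ∀ y ∈ p, B y (w j) = 0 := fun y hy => H.pw y hy j (by simp)
    have hwj : ∀ j', Sum.inr j' ∈ c → B (w j) (w j') = 0 := by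
      intro j' hj'
      exact D.wo _ _ (by rintro rfl; exact hac hj')
    have hei : ∀ i' ∈ I.erase i, ∀ s t, B (h i s) (h i' t) = 0 := by
      intro i' hi' s t
      exact D.ho _ _ (Ne.symm (Finset.mem_erase.1 hi').1) _ _
    have q3 : B (h i true) (h i false) = 1 := D.hp i true
    have q4 : B (h i false) (h i true) = 1 := D.hp i false
    have T1 := one i hi hic (w j + h i true - (B (w j) (w j) / 2) • h i false)
      (by simp [D.hh, D.wh, hw, q3, q4]; field_simp; ring)
      (by intro y hy; simp [hpw y hy, H.ph y hy i hi])
      (by intro i' hi' s; simp [D.wh, hei i' hi'])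
      (by intro j' hj'; simp [hwj j' hj', hw])
    have T2 : ∀ s, _ := fun s => one i hi hic (h i s) (D.hh _ _)
      (fun y hy => H.ph y hy i hi s) (fun i' hi' t => hei i' hi' s t) (fun j' _ => hw i s j')
    have S := (GG B (p.length + m)).add_mem ((GG B (p.length + m)).sub_mem T1 (T2 true))
      ((GG B (p.length + m)).smul_mem (B (w j) (w j) / 2) (T2 false))
    convert S using 1
    simp [fam, add_mul, mul_add, sub_mul, mul_sub]
    abel

theorem GG_eq {B : LinearMap.BilinForm F V} {h : Fin n → Bool → V} {w : J → V}
    (two : (2 : F) ≠ 0) (D : HypData B h w)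
    (hspan : Submodule.span F (Set.range (fam h w)) = ⊤) (k : ℕ) (hk : k ≤ n) :
    ⋀[F]^k V ≤ GG B k := by
  have : LinearMap.range (ExteriorAlgebra.ι F : V →ₗ[F] ExteriorAlgebra F V)
      = Submodule.span F (ExteriorAlgebra.ι F '' Set.range (fam h w)) := by
    rw [← Submodule.map_span, hspan, Submodule.map_top]
  unfold ExteriorAlgebra.exteriorPower
  rw [this, Submodule.span_pow, Submodule.span_le]
  intro x hx
  obtain ⟨f, rfl⟩ := Set.mem_pow.1 hx
  have hf : ∀ t, ∃ a, ExteriorAlgebra.ι F (fam h w a) = (f t : ExteriorAlgebra F V) := by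
    intro t
    obtain ⟨_, ⟨a, rfl⟩, ha⟩ := (f t).2
    exact ⟨a, ha⟩
  choose g hg using hf
  simp only [← hg, SetLike.mem_coe]
  by_cases hinj : Function.Injective g
  · have := main_step two D k (List.ofFn g) Finset.univ [] (by simp)
      (List.nodup_ofFn.2 hinj) (by simpa using hk) (by simp)
      ⟨by intro x hx; simp at hx, by simp, by simp⟩
    simpa [wedge, List.map_ofFn, Function.comp_def] using this
  · rw [← ExteriorAlgebra.ιMulti_apply]
    rw [AlternatingMap.map_eq_zero_of_not_injective]
    · exact Submodule.zero_mem _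
    · intro hh
      exact hinj (fun a b hab => hh (by simp [hab]))

theorem GG_le (two : (2 : F) ≠ 0) (q : QuadraticForm F V) (k : ℕ) :
    GG q.polarBilin k ≤ grassmann F V (TotSingQ F V q) k := by
  unfold GG
  rw [Submodule.span_le]
  rintro _ ⟨l, rfl, hl, rfl⟩
  have e : wedge l = ExteriorAlgebra.ιMulti F l.length l.get := by
    rw [ExteriorAlgebra.ιMulti_apply, wedge]
    congr 1
    conv_lhs => rw [← List.ofFn_get l, List.map_ofFn]
    rfl
  by_cases hli : LinearIndependent F l.get
  · refine Submodule.subset_span ⟨l.get, by simp, hli, ?_, e⟩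
    have hr : Set.range l.get = {x | x ∈ l} := Set.range_list_get l
    rw [hr]
    have h1 : ∀ y ∈ l, ∀ x ∈ Submodule.span F {x | x ∈ l}, q.polarBilin x y = 0 := by
      intro y hy x hx
      induction hx using Submodule.span_induction with
      | mem x hx => exact hl x hx y hy
      | zero => simp
      | add a b _ _ ha hb => rw [map_add, LinearMap.add_apply, ha, hb, add_zero]
      | smul a x _ hx => rw [map_smul, LinearMap.smul_apply, hx, smul_zero]
    intro x hx
    have h2 : ∀ y ∈ Submodule.span F {x | x ∈ l}, q.polarBilin x y = 0 := by
      intro y hy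
      induction hy using Submodule.span_induction with
      | mem y hy => exact h1 y hy x hx
      | zero => simp
      | add a b _ _ ha hb => rw [map_add, ha, hb, add_zero]
      | smul a x _ hx => rw [map_smul, hx, smul_zero]
    have h3 := h2 x hx
    rw [QuadraticMap.polarBilin_apply_apply, QuadraticMap.polar_self] at h3
    simpa [two] using h3
  · rw [e, AlternatingMap.map_linearDependent _ _ hli]
    exact Submodule.zero_mem _

theorem grassmann_le (P : Submodule F V → Prop) (k : ℕ) :
    grassmann F V P k ≤ ⋀[F]^k V := by
  unfold grassmann grassmannIn
  rw [Submodule.span_le]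
  rintro _ ⟨v, -, -, -, rfl⟩
  exact ExteriorAlgebra.ιMulti_range F k ⟨v, rfl⟩

theorem exists_hypData [FiniteDimensional F V] (two : (2 : F) ≠ 0) (q : QuadraticForm F V)
    (n d₀ d : ℕ)
    (hdec : HasWittDecomp F V (polarF F V q) (fun v => q v = 0) (radSetQ F V q) n d₀ d) :
    ∃ (m : ℕ) (h : Fin n → Bool → V) (w : Fin m → V), HypData q.polarBilin h w ∧
      Submodule.span F (Set.range (fam h w)) = ⊤ := by
  obtain ⟨W, W₀, R, hdirect, horth, hhyp, -, -, -, -⟩ := hdec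
  choose e f hW he hf hef using hhyp
  have htop := hdirect.submodule_iSup_eq_top
  have symm : ∀ x y, q.polarBilin x y = q.polarBilin y x := fun x y => by
    simp [QuadraticMap.polar_comm (⇑q) x y]
  have hpol : ∀ x y, q.polarBilin x y = polarF F V q x y := fun x y => rfl
  have hself : ∀ x, q x = 0 → q.polarBilin x x = 0 := fun x hx => by
    rw [QuadraticMap.polarBilin_apply_apply, QuadraticMap.polar_self, hx, smul_zero]
  have : Invertible (2 : F) := invertibleOfNonzero two
  set U : Submodule F V := W₀ ⊔ R with hU
  let BU : LinearMap.BilinForm F U := LinearMap.BilinForm.restrict q.polarBilin U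
  have hBU : BU.IsSymm := ⟨fun x y => symm x y⟩
  obtain ⟨v, hv⟩ := LinearMap.BilinForm.exists_orthogonal_basis (V := U) (B := BU)
    (LinearMap.BilinForm.isSymm_iff.1 hBU)
  let h : Fin n → Bool → V := fun i s => if s then e i else f i
  have hmem : ∀ i s, h i s ∈ W i := by
    intro i s
    rw [hW i]
    apply Submodule.subset_span
    cases s <;> simp [h]
  have hUW : ∀ u ∈ U, ∀ i, ∀ x ∈ W i, q.polarBilin u x = 0 := by
    intro u hu i x hx
    obtain ⟨a, ha, b, hb, rfl⟩ := Submodule.mem_sup.1 hu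
    have h1 : q.polarBilin a x = 0 :=
      horth (Sum.inr 0) (Sum.inl i) (by simp) a (by simpa using ha) x (by simpa using hx)
    have h2 : q.polarBilin b x = 0 :=
      horth (Sum.inr 1) (Sum.inl i) (by simp) b (by simpa using hb) x (by simpa using hx)
    rw [map_add, LinearMap.add_apply, h1, h2, add_zero]
  refine ⟨_, h, fun j => (v j : V), ⟨symm, ?_, ?_, ?_, ?_, ?_⟩, ?_⟩
  · intro i s
    cases s
    · exact hself _ (hf i)
    · exact hself _ (he i)
  · intro i s
    cases s
    · rw [symm]; exact hef i
    · exact hef i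
  · intro i i' hii s t
    exact horth (Sum.inl i) (Sum.inl i') (by simpa using hii) _ (hmem i s) _ (hmem i' t)
  · intro j j' hjj
    exact hv hjj
  · intro j i s
    exact hUW _ (v j).2 i _ (hmem i s)
  · rw [eq_top_iff, ← htop, iSup_le_iff]
    have hUle : U ≤ Submodule.span F (Set.range (fam h fun j => (v j : V))) := by
      have : U = Submodule.span F (Set.range fun j => (v j : V)) := by
        have h1 := congrArg (Submodule.map U.subtype) v.span_eq
        rw [Submodule.map_span, Submodule.map_top, Submodule.range_subtype, ← Set.range_comp] at h1
        exact h1.symm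
      refine this.le.trans (Submodule.span_mono ?_)
      rintro _ ⟨j, rfl⟩
      exact ⟨Sum.inr j, rfl⟩
    rintro (i | j)
    · simp only [Sum.elim_inl]
      rw [hW i, Submodule.span_le]
      rintro x (rfl | rfl)
      · exact Submodule.subset_span ⟨Sum.inl (i, true), rfl⟩
      · exact Submodule.subset_span ⟨Sum.inl (i, false), rfl⟩
    · fin_cases j
      · exact le_sup_left.trans hUle
      · exact le_sup_right.trans hUle

end Aux

end PolarGrass

open PolarGrass Module in
/-- `char F ≠ 2`, a possibly degenerate quadratic form of reduced Witt index
`n ≥ 2`, anisotropic defect `d₀` and singular defect `d` (`N = 2n + d₀ + d`); for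
`1 ≤ k ≤ n` the Grassmann image fills `⋀^k V`, of dimension `N.choose k`. -/
theorem stmt2 (F : Type*) [Field F] (V : Type*) [AddCommGroup V] [Module F V]
    [FiniteDimensional F V]
    (hchar : ringChar F ≠ 2)
    (q : QuadraticForm F V)
    (n d₀ d N : ℕ) (hn : 2 ≤ n)
    (hdec : HasWittDecomp F V (polarF F V q) (fun v => q v = 0) (radSetQ F V q) n d₀ d)
    (hNV : Module.finrank F V = N) (hN : N = 2 * n + d₀ + d) :
    ∀ k : ℕ, 1 ≤ k → k ≤ n →
      grassmann F V (TotSingQ F V q) k = ⋀[F]^k V ∧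
      Module.finrank F ↥(grassmann F V (TotSingQ F V q) k) = N.choose k := by
  intro k _ hk
  have two : (2 : F) ≠ 0 := Ring.two_ne_zero hchar
  obtain ⟨m, h, w, D, hspan⟩ := exists_hypData two q n d₀ d hdec
  have heq : grassmann F V (TotSingQ F V q) k = ⋀[F]^k V :=
    le_antisymm (grassmann_le _ k) ((GG_eq two D hspan k hk).trans (GG_le two q k))
  refine ⟨heq, ?_⟩
  rw [heq, exteriorPower.finrank_eq, hNV]
end
end
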